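/- arXiv:1802.06266 — 4 statements merged into one kernel-verified Lean document; each statement's English description precedes it below -/
import Mathlib

section
/- Let S > q be an integer and ν be a positive measure on 𝕋^q such that ν(B(x, r)) ≤ A_ν (r + d)^q for all r > 0 and x ∈ 𝕋^q, for some constants A_ν > 0 and d ≥ 0. Then for every N ≥ 1 and every r ≥ 1/N, ∫_{𝕋^q \ B(x, r)} |Φ_N(x − u)| dν(u) ≤ c A_ν (Nr)^{q−S} (1 + d/r)^q, where c depends only on q, S, h (not on r, d, or ν). -/
open MeasureTheory Real

noncomputable section

instance fact_two_pi_pos : Fact (0 < 2 * π) := ⟨by positivity⟩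

/-- The `q`-dimensional torus `ℝ^q/(2πℤ)^q`, with the max metric. -/
abbrev Torus (q : ℕ) := Fin q → AddCircle (2 * π)

/-- The exponential `x ↦ exp(i k·x)` on the torus. -/
def eK {q : ℕ} (k : Fin q → ℤ) : C(Torus q, ℂ) :=
  ⟨fun x => ∏ j, fourier (k j) (x j),
    continuous_finset_prod _ fun j _ => (map_continuous (fourier (k j))).comp (continuous_apply j)⟩

/-- The Euclidean norm `|k|₂` of a multi-integer. -/
def l2 {q : ℕ} (k : Fin q → ℤ) : ℝ := Real.sqrt (∑ j, ((k j : ℝ)) ^ 2)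

/-- The space `H_n^q` of trigonometric polynomials of spherical degree `< n`. -/
def trigSpan (q : ℕ) (n : ℝ) : Submodule ℂ C(Torus q, ℂ) :=
  Submodule.span ℂ {T | ∃ k : Fin q → ℤ, l2 k < n ∧ T = eK k}

/-- The degree of approximation `E_n(q; f)` in the supremum norm. -/
def degApprox (q : ℕ) (n : ℝ) (f : C(Torus q, ℂ)) : ℝ :=
  ⨅ T : ↥(trigSpan q n), ‖f - (T : C(Torus q, ℂ))‖

/-- The multivariate Fourier coefficient `f̂(k)`. -/
def mFourierCoeff {q : ℕ} (f : C(Torus q, ℂ)) (k : Fin q → ℤ) : ℂ :=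
  (1 / ((2 * π : ℝ) : ℂ) ^ q) * ∫ x : Torus q, f x * (starRingEnd ℂ) (eK k x)

/-- The box of frequencies used to write `Φ_N` and `σ_N` as finite sums. -/
def box (q : ℕ) (N : ℝ) : Finset (Fin q → ℤ) :=
  Finset.Icc (fun _ => -⌈N⌉) (fun _ => ⌈N⌉)

/-- The fixed smooth cutoff function `h`. -/
structure SmoothCutoff (h : ℝ → ℝ) : Prop where
  smooth : ContDiff ℝ (⊤ : ℕ∞) h
  even : ∀ t, h (-t) = h t
  nonneg : ∀ t, 0 ≤ h t
  le_one : ∀ t, h t ≤ 1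
  eq_one : ∀ t, |t| ≤ 1 / 2 → h t = 1
  eq_zero : ∀ t, 1 ≤ |t| → h t = 0

/-- The localized kernel `Φ_N(x) = Σ_k h(|k|₂/N) exp(i k·x)`. -/
def Phi (q : ℕ) (h : ℝ → ℝ) (N : ℝ) : C(Torus q, ℂ) :=
  ∑ k ∈ box q N, ((h (l2 k / N) : ℝ) : ℂ) • eK k

/-- The operator `σ_N(f)(x) = Σ_k h(|k|₂/N) f̂(k) exp(i k·x)`. -/
def sigmaOp (q : ℕ) (h : ℝ → ℝ) (N : ℝ) (f : C(Torus q, ℂ)) : C(Torus q, ℂ) :=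
  ∑ k ∈ box q N, (((h (l2 k / N) : ℝ) : ℂ) * mFourierCoeff f k) • eK k

/-- Minimal separation `η(C)` of the points of `C = {x_1, …, x_M}`. -/
def minSep {q M : ℕ} (x : Fin M → Torus q) : ℝ :=
  sInf {d | ∃ i j, x i ≠ x j ∧ d = dist (x i) (x j)}

/-- `x ↦ k·x` on the torus. -/
def dotk {q : ℕ} (k : Fin q → ℤ) : C(Torus q, AddCircle (2 * π)) :=
  ⟨fun x => ∑ j, k j • x j,
    continuous_finset_sum _ fun j _ => (continuous_zsmul (k j)).comp (continuous_apply j)⟩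

/-- `x ↦ φ(k·x − t)`, a single neuron. -/
def transK {q : ℕ} (φ : C(AddCircle (2 * π), ℂ)) (k : Fin q → ℤ) (t : ℝ) : C(Torus q, ℂ) :=
  φ.comp ⟨fun x => dotk k x - (t : AddCircle (2 * π)), (dotk k).continuous.sub continuous_const⟩

/-- The network `𝔾_Nt(φ, T)` associated with the trigonometric polynomial
`T = Σ_{k ∈ K} c k exp(i k ⬝ ·)`. -/
def Gop {q : ℕ} (φ : C(AddCircle (2 * π), ℂ)) (Nt : ℕ) (K : Finset (Fin q → ℤ))
    (c : (Fin q → ℤ) → ℂ) : C(Torus q, ℂ) :=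
  (1 / (((2 * Nt + 1 : ℕ) : ℂ) * fourierCoeff (⇑φ) 1)) •
    ∑ j ∈ Finset.range (2 * Nt + 1),
      Complex.exp (2 * (π : ℂ) * Complex.I * (j : ℂ) / ((2 * Nt + 1 : ℕ) : ℂ)) •
        ∑ k ∈ K, c k • transK φ k (2 * π * (j : ℝ) / ((2 * Nt + 1 : ℕ) : ℝ))

/-- The network `𝔾_Nt(φ, Φ_N)`. -/
def GPhiOp (q : ℕ) (h : ℝ → ℝ) (φ : C(AddCircle (2 * π), ℂ)) (Nt : ℕ) (N : ℝ) :
    C(Torus q, ℂ) :=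
  Gop φ Nt (box q N) fun k => ((h (l2 k / N) : ℝ) : ℂ)

/-- The network `𝔾_Nt(φ, σ_n(f))`. -/
def GsigmaOp (q : ℕ) (h : ℝ → ℝ) (φ : C(AddCircle (2 * π), ℂ)) (Nt : ℕ) (n : ℝ)
    (f : C(Torus q, ℂ)) : C(Torus q, ℂ) :=
  Gop φ Nt (box q n) fun k => ((h (l2 k / n) : ℝ) : ℂ) * mFourierCoeff f k

/-- Univariate trigonometric polynomials of degree `< n`. -/
def trigSpan1 (n : ℝ) : Submodule ℂ C(AddCircle (2 * π), ℂ) :=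
  Submodule.span ℂ {T | ∃ k : ℤ, |(k : ℝ)| < n ∧ T = fourier k}

/-- The univariate degree of approximation `E_n(1; φ)`. -/
def degApprox1 (n : ℝ) (φ : C(AddCircle (2 * π), ℂ)) : ℝ :=
  ⨅ T : ↥(trigSpan1 n), ‖φ - (T : C(AddCircle (2 * π), ℂ))‖

/-- Univariate trigonometric polynomials of degree `≤ m`. -/
def trigSpanLe1 (m : ℝ) : Submodule ℂ C(AddCircle (2 * π), ℂ) :=
  Submodule.span ℂ {T | ∃ k : ℤ, |(k : ℝ)| ≤ m ∧ T = fourier k}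

/-- The degree of approximation by univariate trigonometric polynomials of degree `≤ m`. -/
def degApproxLe1 (m : ℝ) (φ : C(AddCircle (2 * π), ℂ)) : ℝ :=
  ⨅ T : ↥(trigSpanLe1 m), ‖φ - (T : C(AddCircle (2 * π), ℂ))‖

/-- Projection of `ℝ^q` onto the torus. -/
def projT {q : ℕ} (x : Fin q → ℝ) : Torus q := fun j => (x j : AddCircle (2 * π))

/-- The `2π`-periodic lift to `ℝ^q` of a function on the torus. -/
def liftT {q : ℕ} (f : C(Torus q, ℂ)) : (Fin q → ℝ) → ℂ := fun x => f (projT x)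

/-- `f ∈ W*(𝕋^q)`: `f` is continuously differentiable. -/
def MemW {q : ℕ} (f : C(Torus q, ℂ)) : Prop := ContDiff ℝ 1 (liftT f)

/-- The `W*` seminorm `Σ_j ‖D_j f‖`. -/
def Wnorm {q : ℕ} (f : C(Torus q, ℂ)) : ℝ :=
  ∑ j, ⨆ x : Fin q → ℝ, ‖fderiv ℝ (liftT f) x (Pi.single j 1)‖

/-- Degree of approximation of a (not necessarily continuous) periodic function on `ℝ^q`. -/
def degApprox' (q : ℕ) (n : ℝ) (g : (Fin q → ℝ) → ℂ) : ℝ :=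
  ⨅ T : ↥(trigSpan q n), ⨆ x : Fin q → ℝ, ‖g x - (T : C(Torus q, ℂ)) (projT x)‖

/-- Degree of approximation of a (not necessarily continuous) `2π`-periodic function on `ℝ`. -/
def degApprox1' (n : ℝ) (g : ℝ → ℂ) : ℝ :=
  ⨅ T : ↥(trigSpan1 n), ⨆ t : ℝ, ‖g t - (T : C(AddCircle (2 * π), ℂ)) (t : AddCircle (2 * π))‖

/-- The regularization functional `R_N(T)`. -/
def regFunc {q M : ℕ} (N : ℝ) (x : Fin M → Torus q) (y : Fin M → ℂ) (T : C(Torus q, ℂ)) : ℝ :=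
  (⨆ j, ‖y j - T (x j)‖) + (1 / N) * Wnorm T

/-- Translate of a function on the torus. -/
def translateC {q : ℕ} (g : C(Torus q, ℂ)) (z : Torus q) : C(Torus q, ℂ) :=
  g.comp ⟨fun w => w - z, continuous_id.sub continuous_const⟩

/-- The interpolant `T^#_N(D) = σ_N(f) + Σ_j a_j Φ_N(· − x_j)`. -/
def interpolant {q M : ℕ} (h : ℝ → ℝ) (N : ℝ) (f : C(Torus q, ℂ)) (x : Fin M → Torus q)
    (a : Fin M → ℂ) : C(Torus q, ℂ) :=
  sigmaOp q h N f + ∑ j, a j • translateC (Phi q h N) (x j)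

end

section ForwardDifference

variable {E : Type*} [NormedAddCommGroup E] [NormedSpace ℝ E]

/-- Iterated forward differences commute with line derivatives. -/
theorem hasLineDerivAt_fwdDiff_iter {f f' : E → ℝ} {e : E} (v : E)
    (hf : ∀ y, HasLineDerivAt ℝ f (f' y) y e) (n : ℕ) (y : E) :
    HasLineDerivAt ℝ ((fwdDiff v)^[n] f) ((fwdDiff v)^[n] f' y) y e := by
  induction n generalizing f f' with
  | zero => exact hf y
  | succ n ih =>
    refine ih fun z => ?_
    have h : HasDerivAt (fun t : ℝ => f (z + v + t • e) - f (z + t • e)) (f' (z + v) - f' z) 0 :=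
      (hf (z + v)).sub (hf z)
    simpa only [HasLineDerivAt, fwdDiff, add_right_comm] using h

/-- The `n`-th forward difference in a fixed direction of a smooth compactly supported function is
uniformly of order `n` in the step length. -/
theorem exists_abs_fwdDiff_iter_le (e : E) (n : ℕ) {f : E → ℝ} (hf : ContDiff ℝ (⊤ : ℕ∞) f)
    (hc : HasCompactSupport f) :
    ∃ C, 0 ≤ C ∧ ∀ (t : ℝ) (y : E), |(fwdDiff (t • e))^[n] f y| ≤ C * |t| ^ n := by
  induction n generalizing f with
  | zero =>
    obtain ⟨C, hC⟩ := hc.exists_bound_of_continuous hf.continuous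
    exact ⟨C, (norm_nonneg _).trans (hC 0), fun t y => by simpa using hC y⟩
  | succ n ih =>
    have hdiff : Differentiable ℝ f := hf.differentiable (by simp)
    have hf' : ContDiff ℝ (⊤ : ℕ∞) (fun y => fderiv ℝ f y e) :=
      (hf.fderiv_right (m := (⊤ : ℕ∞)) (by simp)).clm_apply contDiff_const
    obtain ⟨C, hC0, hC⟩ := ih hf' (hc.fderiv_apply (𝕜 := ℝ) e)
    refine ⟨C, hC0, fun t y => ?_⟩
    set G := (fwdDiff (t • e))^[n] f with hG
    set G' := (fwdDiff (t • e))^[n] (fun y => fderiv ℝ f y e) with hG'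
    have hline (z : E) : HasLineDerivAt ℝ G (G' z) z e :=
      hasLineDerivAt_fwdDiff_iter _ (fun w => (hdiff w).hasFDerivAt.hasLineDerivAt e) n z
    have hderiv (s : ℝ) : HasDerivAt (fun s : ℝ => G (y + (s * t) • e))
        (G' (y + (s * t) • e) * t) s := by
      have h₁ := hline (y + (s * t) • e)
      unfold HasLineDerivAt at h₁
      have h₂ : HasDerivAt (fun r : ℝ => (r - s) * t) t s := by
        simpa using ((hasDerivAt_id s).sub_const s).mul_const t
      have h₃ := HasDerivAt.comp_of_eq s h₁ h₂ (by simp)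
      refine h₃.congr_of_eventuallyEq (Filter.Eventually.of_forall fun r => ?_)
      simp only [Function.comp, add_assoc, ← add_smul]
      congr 3
      ring
    have := norm_image_sub_le_of_norm_deriv_le_segment_01' (C := C * |t| ^ n * |t|)
      (fun s _ => (hderiv s).hasDerivWithinAt) (fun s _ => by
        rw [norm_mul]
        exact mul_le_mul_of_nonneg_right (hC t _) (abs_nonneg t))
    rw [Function.iterate_succ_apply', ← hG, fwdDiff, pow_succ, ← mul_assoc]
    simpa using this

end ForwardDifference

/-- The chord length on the unit circle is comparable to the arc length. -/
theorem two_div_pi_mul_norm_le_norm_fourier_one_sub_one (z : AddCircle (2 * π)) :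
    2 / π * ‖z‖ ≤ ‖(fourier 1 z : ℂ) - 1‖ := by
  obtain ⟨y, hy, rfl⟩ : ∃ y : ℝ, |y| ≤ π ∧ (y : AddCircle (2 * π)) = z := by
    have hz : z ∈ ((↑) : ℝ → AddCircle (2 * π)) '' Set.Ico (-π) (-π + 2 * π) := by
      rw [AddCircle.coe_image_Ico_eq]; trivial
    obtain ⟨y, hy, rfl⟩ := hz
    exact ⟨y, abs_le.2 ⟨hy.1, by linarith [hy.2]⟩, rfl⟩
  have hpi := Real.pi_pos
  have hn : ‖(y : AddCircle (2 * π))‖ = |y| := by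
    rw [AddCircle.norm_coe_eq_abs_iff _ (by positivity), abs_of_pos (two_pi_pos)]
    linarith
  have hf : (fourier 1 (y : AddCircle (2 * π)) : ℂ) = Complex.exp (Complex.I * y) := by
    rw [fourier_coe_apply]
    congr 1
    push_cast
    field_simp
  rw [hn, hf, Complex.norm_exp_I_mul_ofReal_sub_one, Real.norm_eq_abs, abs_mul, abs_two]
  have := Real.mul_abs_le_abs_sin (x := y / 2) (by rw [abs_div, abs_two]; linarith)
  rw [abs_div, abs_two] at this
  linarith

/-- A radial cutoff built from a smooth cutoff function is smooth on Euclidean space. -/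
theorem SmoothCutoff.contDiff_norm {h : ℝ → ℝ} (hh : SmoothCutoff h) (q : ℕ) :
    ContDiff ℝ (⊤ : ℕ∞) fun y : EuclideanSpace ℝ (Fin q) => h ‖y‖ := by
  refine contDiff_iff_contDiffAt.2 fun y => ?_
  by_cases hy : y = 0
  · have : (fun y : EuclideanSpace ℝ (Fin q) => h ‖y‖) =ᶠ[nhds y] fun _ => 1 := by
      filter_upwards [Metric.ball_mem_nhds y (show (0 : ℝ) < 1 / 2 by norm_num)] with z hz
      apply hh.eq_one
      rw [hy, mem_ball_zero_iff] at hz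
      rw [abs_norm]; exact hz.le
    exact contDiffAt_const.congr_of_eventuallyEq this
  · exact hh.smooth.contDiffAt.comp y (contDiffAt_norm ℝ hy)

theorem SmoothCutoff.hasCompactSupport_norm {h : ℝ → ℝ} (hh : SmoothCutoff h) (q : ℕ) :
    HasCompactSupport fun y : EuclideanSpace ℝ (Fin q) => h ‖y‖ := by
  refine HasCompactSupport.of_support_subset_isCompact
    (isCompact_closedBall (0 : EuclideanSpace ℝ (Fin q)) 1) fun y hy => ?_
  by_contra hcon
  rw [mem_closedBall_zero_iff, not_le] at hcon
  exact hy (hh.eq_zero _ (by rw [abs_norm]; exact hcon.le))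

theorem eK_add_single {q : ℕ} (k : Fin q → ℤ) (j : Fin q) (x : Torus q) :
    eK (k + Pi.single j 1) x = fourier 1 (x j) * eK k x := by
  have (i : Fin q) : (fourier ((k + Pi.single j 1 : Fin q → ℤ) i) (x i) : ℂ) =
      (fourier (Pi.single (M := fun _ => ℤ) j 1 i) (x i)) * fourier (k i) (x i) := by
    rw [← fourier_add, Pi.add_apply, add_comm]
  simp only [eK, ContinuousMap.coe_mk, this, Finset.prod_mul_distrib]
  congr 1
  rw [Finset.prod_eq_single j]
  · simp
  · intro i _ hi
    simp [Pi.single_eq_of_ne hi]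
  · simp

theorem norm_eK_apply {q : ℕ} (k : Fin q → ℤ) (x : Torus q) : ‖eK k x‖ = 1 := by
  simp only [eK, ContinuousMap.coe_mk, norm_prod]
  exact Finset.prod_eq_one fun j _ => Circle.norm_coe _

theorem finsum_fwdDiff_mul_eK {q : ℕ} {a : (Fin q → ℤ) → ℝ} (ha : a.support.Finite)
    (j : Fin q) (x : Torus q) :
    ∑ᶠ k, ((fwdDiff (-Pi.single j 1) a k : ℝ) : ℂ) * eK k x =
      (fourier 1 (x j) - 1) * ∑ᶠ k, (a k : ℂ) * eK k x := by
  set v : Fin q → ℤ := -Pi.single j 1 with hv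
  have hfin : (Function.support fun k => (a k : ℂ) * eK k x).Finite :=
    ha.subset fun k hk hak => hk (by simp [hak])
  have hfin' : (Function.support fun k => (a (k + v) : ℂ) * eK k x).Finite := by
    refine (ha.preimage ((add_left_injective v).injOn)).subset fun k hk hak => hk ?_
    simp only [hak, Complex.ofReal_zero, zero_mul]
  have hshift : ∑ᶠ k, (a (k + v) : ℂ) * eK k x =
      fourier 1 (x j) * ∑ᶠ k, (a k : ℂ) * eK k x := by
    rw [mul_finsum' _ _ hfin, ← finsum_comp_equiv (Equiv.subRight v)]
    refine finsum_congr fun k => ?_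
    simp only [Equiv.subRight_apply, sub_add_cancel]
    rw [hv, sub_neg_eq_add, eK_add_single]
    ring
  rw [sub_one_mul, ← hshift, ← finsum_sub_distrib hfin' hfin]
  refine finsum_congr fun k => ?_
  simp only [fwdDiff, Complex.ofReal_sub, sub_mul]

/-- The coefficients `a` vanish outside the cube of half side length `R`. -/
def SupportedInCube {q : ℕ} (a : (Fin q → ℤ) → ℝ) (R : ℤ) : Prop :=
  ∀ k, a k ≠ 0 → k ∈ Finset.Icc (fun _ : Fin q => -R) (fun _ => R)

theorem SupportedInCube.finite {q : ℕ} {a : (Fin q → ℤ) → ℝ} {R : ℤ}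
    (ha : SupportedInCube a R) : a.support.Finite :=
  (Finset.finite_toSet _).subset fun k hk => ha k hk

theorem SupportedInCube.fwdDiff {q : ℕ} {a : (Fin q → ℤ) → ℝ} {R : ℤ}
    (ha : SupportedInCube a R) (j : Fin q) :
    SupportedInCube (fwdDiff (-Pi.single j 1) a) (R + 1) := by
  intro k hk
  have hs (i : Fin q) : 0 ≤ (Pi.single j 1 : Fin q → ℤ) i ∧ (Pi.single j 1 : Fin q → ℤ) i ≤ 1 := by
    rcases eq_or_ne i j with rfl | hi
    · simp
    · simp [Pi.single_eq_of_ne hi]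
  rw [Finset.mem_Icc, Pi.le_def, Pi.le_def]
  by_cases h₀ : a k = 0
  · have h₁ : a (k + -Pi.single j 1) ≠ 0 := fun h => hk (by simp [_root_.fwdDiff, h, h₀])
    have h₂ := ha _ h₁
    rw [Finset.mem_Icc, Pi.le_def, Pi.le_def] at h₂
    refine ⟨fun i => ?_, fun i => ?_⟩
    · have := h₂.1 i
      have := hs i
      simp only [Pi.add_apply, Pi.neg_apply] at *
      lia
    · have := h₂.2 i
      have := hs i
      simp only [Pi.add_apply, Pi.neg_apply] at *
      lia
  · have h₂ := ha _ h₀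
    rw [Finset.mem_Icc, Pi.le_def, Pi.le_def] at h₂
    exact ⟨fun i => by have := h₂.1 i; lia, fun i => by have := h₂.2 i; lia⟩

theorem SupportedInCube.fwdDiff_iter {q : ℕ} {a : (Fin q → ℤ) → ℝ} {R : ℤ}
    (ha : SupportedInCube a R) (j : Fin q) (n : ℕ) :
    SupportedInCube ((_root_.fwdDiff (-Pi.single j 1))^[n] a) (R + n) := by
  induction n with
  | zero => simpa using ha
  | succ n ih =>
    rw [Function.iterate_succ_apply']
    simpa [add_assoc] using ih.fwdDiff j

theorem finsum_fwdDiff_iter_mul_eK {q : ℕ} {a : (Fin q → ℤ) → ℝ} {R : ℤ}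
    (ha : SupportedInCube a R) (j : Fin q) (n : ℕ) (x : Torus q) :
    ∑ᶠ k, (((fwdDiff (-Pi.single j 1))^[n] a k : ℝ) : ℂ) * eK k x =
      (fourier 1 (x j) - 1) ^ n * ∑ᶠ k, (a k : ℂ) * eK k x := by
  induction n with
  | zero => simp
  | succ n ih =>
    simp only [Function.iterate_succ_apply']
    rw [finsum_fwdDiff_mul_eK (ha.fwdDiff_iter j n).finite, ih, pow_succ']
    ring

theorem SupportedInCube.finsum_eq_sum {q : ℕ} {a : (Fin q → ℤ) → ℝ} {R : ℤ}
    (ha : SupportedInCube a R) (x : Torus q) :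
    ∑ᶠ k, (a k : ℂ) * eK k x =
      ∑ k ∈ Finset.Icc (fun _ : Fin q => -R) (fun _ => R), (a k : ℂ) * eK k x :=
  finsum_eq_sum_of_support_subset _ fun k hk => ha k fun h => hk (by simp [h])

theorem SupportedInCube.norm_finsum_le {q : ℕ} {a : (Fin q → ℤ) → ℝ} {R : ℤ} (hR : 0 ≤ R)
    (ha : SupportedInCube a R) {B : ℝ} (hB : ∀ k, |a k| ≤ B) (x : Torus q) :
    ‖∑ᶠ k, (a k : ℂ) * eK k x‖ ≤ (2 * R + 1) ^ q * B := by
  rw [ha.finsum_eq_sum]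
  refine (norm_sum_le_of_le _ (f := fun k => (a k : ℂ) * eK k x) (n := fun _ => B)
    fun k _ => ?_).trans ?_
  · rw [norm_mul, norm_eK_apply, mul_one, Complex.norm_real]
    exact hB k
  · rw [Finset.sum_const, Pi.card_Icc, nsmul_eq_mul]
    simp only [Int.card_Icc, Finset.prod_const, Finset.card_univ, Fintype.card_fin]
    have : ((R + 1 - -R).toNat : ℝ) = 2 * R + 1 := by
      have : ((R + 1 - -R).toNat : ℤ) = 2 * R + 1 := by lia
      exact_mod_cast this
    rw [Nat.cast_pow, this]

theorem l2_eq_norm {q : ℕ} (k : Fin q → ℤ) :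
    l2 k = ‖WithLp.toLp 2 (fun i => (k i : ℝ))‖ := by
  simp [l2, EuclideanSpace.norm_eq]

theorem SmoothCutoff.supportedInCube {h : ℝ → ℝ} (hh : SmoothCutoff h) (q : ℕ) {N : ℝ}
    (hN : 0 < N) : SupportedInCube (fun k : Fin q → ℤ => h (l2 k / N)) ⌈N⌉ := by
  intro k hk
  have hlt : l2 k < N := by
    by_contra! hcon
    refine hk (hh.eq_zero _ ?_)
    exact ((one_le_div hN).2 hcon).trans (le_abs_self _)
  have hi (i : Fin q) : |k i| ≤ ⌈N⌉ := by
    have h₁ : |(k i : ℝ)| ≤ l2 k := by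
      rw [l2_eq_norm]
      exact PiLp.norm_apply_le (WithLp.toLp 2 fun i => (k i : ℝ)) i
    have h₂ : ((|k i| : ℤ) : ℝ) ≤ (⌈N⌉ : ℤ) := by
      rw [Int.cast_abs]
      exact (h₁.trans hlt.le).trans (Int.le_ceil N)
    exact_mod_cast h₂
  exact Finset.mem_Icc.2 ⟨fun i => (abs_le.1 (hi i)).1, fun i => (abs_le.1 (hi i)).2⟩

theorem SmoothCutoff.Phi_apply_eq_finsum {h : ℝ → ℝ} (hh : SmoothCutoff h) {q : ℕ} {N : ℝ}
    (hN : 0 < N) (x : Torus q) :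
    Phi q h N x = ∑ᶠ k : Fin q → ℤ, (h (l2 k / N) : ℂ) * eK k x := by
  rw [(hh.supportedInCube q hN).finsum_eq_sum]
  simp [Phi, box, ContinuousMap.sum_apply]

/-- Sampling on a lattice turns unit forward differences into forward differences of
the step length of the lattice. -/
theorem fwdDiff_iter_comp {M M' : Type*} [AddCommMonoid M] [AddCommMonoid M'] (f : M' → ℝ)
    (g : M → M') {v : M} {w : M'} (hg : ∀ k, g (k + v) = g k + w) (n : ℕ) :
    (fwdDiff v)^[n] (f ∘ g) = (fwdDiff w)^[n] f ∘ g := by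
  induction n generalizing f with
  | zero => rfl
  | succ n ih =>
    have : fwdDiff v (f ∘ g) = fwdDiff w f ∘ g := by
      ext k
      simp [fwdDiff, hg]
    rw [Function.iterate_succ_apply, this, ih, Function.iterate_succ_apply]

theorem SmoothCutoff.exists_norm_apply_pow_mul_norm_Phi_le {h : ℝ → ℝ} (hh : SmoothCutoff h)
    (q S : ℕ) (j : Fin q) :
    ∃ C, 0 ≤ C ∧ ∀ (N : ℝ) (x : Torus q), 1 ≤ N →
      (N * ‖x j‖) ^ S * ‖Phi q h N x‖ ≤ C * N ^ q := by
  obtain ⟨C, hC0, hC⟩ := exists_abs_fwdDiff_iter_le (EuclideanSpace.single j (1 : ℝ)) S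
    (hh.contDiff_norm q) (hh.hasCompactSupport_norm q)
  refine ⟨(π / 2) ^ S * ((2 * S + 5) ^ q * C), by positivity, fun N x hN => ?_⟩
  have hN0 : 0 < N := by linarith
  set a : (Fin q → ℤ) → ℝ := fun k => h (l2 k / N) with ha
  set g : (Fin q → ℤ) → EuclideanSpace ℝ (Fin q) :=
    fun k => N⁻¹ • WithLp.toLp 2 (fun i => (k i : ℝ)) with hg
  have hag : a = (fun y : EuclideanSpace ℝ (Fin q) => h ‖y‖) ∘ g := by
    ext k
    simp only [ha, hg, Function.comp, norm_smul, norm_inv, Real.norm_eq_abs, abs_of_pos hN0,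
      l2_eq_norm, div_eq_inv_mul]
  have hgv (k : Fin q → ℤ) : g (k + -Pi.single j 1) =
      g k + (-N⁻¹) • EuclideanSpace.single j (1 : ℝ) := by
    ext i
    rcases eq_or_ne i j with rfl | hi
    · simp [hg]; ring
    · simp [hg, hi]
  have hbound (k : Fin q → ℤ) : |(fwdDiff (-Pi.single j 1))^[S] a k| ≤ C * (N⁻¹) ^ S := by
    rw [hag, fwdDiff_iter_comp _ g hgv]
    simpa [abs_of_pos hN0] using hC (-N⁻¹) (g k)
  have hsupp := hh.supportedInCube q hN0
  have hmain := (hsupp.fwdDiff_iter j S).norm_finsum_le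
    (add_nonneg (Int.ceil_nonneg hN0.le) (Int.natCast_nonneg S)) hbound x
  rw [finsum_fwdDiff_iter_mul_eK hsupp, ← hh.Phi_apply_eq_finsum hN0, norm_mul, norm_pow] at hmain
  have hceil : (2 * ((⌈N⌉ + (S : ℤ) : ℤ) : ℝ) + 1) ≤ (2 * S + 5) * N := by
    have := Int.ceil_lt_add_one N
    push_cast
    nlinarith [(Nat.cast_nonneg S : (0 : ℝ) ≤ S)]
  have hceil0 : (0 : ℝ) ≤ 2 * ((⌈N⌉ + (S : ℤ) : ℤ) : ℝ) + 1 := by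
    have : (0 : ℝ) ≤ ⌈N⌉ := by exact_mod_cast Int.ceil_nonneg hN0.le
    push_cast
    positivity
  have hchord : ‖x j‖ ≤ π / 2 * ‖(fourier 1 (x j) : ℂ) - 1‖ := by
    have := two_div_pi_mul_norm_le_norm_fourier_one_sub_one (x j)
    have hpi := Real.pi_pos
    rw [div_mul_eq_mul_div, div_le_iff₀ hpi] at this
    linarith
  calc (N * ‖x j‖) ^ S * ‖Phi q h N x‖
      ≤ (N * (π / 2 * ‖(fourier 1 (x j) : ℂ) - 1‖)) ^ S * ‖Phi q h N x‖ := by gcongr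
    _ = N ^ S * (π / 2) ^ S * (‖(fourier 1 (x j) : ℂ) - 1‖ ^ S * ‖Phi q h N x‖) := by ring
    _ ≤ N ^ S * (π / 2) ^ S * (((2 * S + 5) * N) ^ q * (C * N⁻¹ ^ S)) := by
        exact mul_le_mul_of_nonneg_left (hmain.trans (by gcongr)) (by positivity)
    _ = (π / 2) ^ S * ((2 * S + 5) ^ q * C) * N ^ q := by
        rw [mul_pow, inv_pow]
        field_simp

/-- The localization estimate for the kernel `Φ_N`. -/
theorem SmoothCutoff.exists_norm_Phi_le {h : ℝ → ℝ} (hh : SmoothCutoff h) (q S : ℕ) :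
    ∃ C > 0, ∀ (N : ℝ) (x : Torus q), 1 ≤ N → 0 < ‖x‖ →
      ‖Phi q h N x‖ ≤ C * N ^ q / (N * ‖x‖) ^ S := by
  choose C hC0 hC using hh.exists_norm_apply_pow_mul_norm_Phi_le q S
  refine ⟨1 + ∑ j, C j, by
    have := Finset.sum_nonneg fun j (_ : j ∈ Finset.univ) => hC0 j
    positivity,
    fun N x hN hx => ?_⟩
  have hN0 : 0 < N := by linarith
  obtain ⟨j, hj⟩ : ∃ j, ‖x‖ ≤ ‖x j‖ := by
    by_contra! hcon
    exact lt_irrefl _ ((pi_norm_lt_iff hx).2 hcon)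
  rw [le_div_iff₀ (by positivity), mul_comm]
  calc (N * ‖x‖) ^ S * ‖Phi q h N x‖ ≤ (N * ‖x j‖) ^ S * ‖Phi q h N x‖ := by gcongr
    _ ≤ C j * N ^ q := hC j N x hN
    _ ≤ (1 + ∑ j, C j) * N ^ q := by
        gcongr
        have := Finset.single_le_sum (f := C) (fun j _ => hC0 j) (Finset.mem_univ j)
        linarith

/-- Lemma on regular measures: if `ν(B(x, r)) ≤ A_ν (r + d)^q` for all balls, then
for `N ≥ 1` and `r ≥ 1/N`,
`∫_{𝕋^q \ B(x,r)} |Φ_N(x − u)| dν(u) ≤ c A_ν (Nr)^{q−S} (1 + d/r)^q`. -/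
theorem kernel_tail_integral (q : ℕ) (h : ℝ → ℝ) (hh : SmoothCutoff h) (S : ℕ) (hS : q < S) :
    ∃ c > 0, ∀ (ν : MeasureTheory.Measure (Torus q)) (A d : ℝ), 0 < A → 0 ≤ d →
      (∀ (x : Torus q) (r : ℝ), 0 < r →
        ν (Metric.closedBall x r) ≤ ENNReal.ofReal (A * (r + d) ^ q)) →
      ∀ (N r : ℝ) (x : Torus q), 1 ≤ N → 1 / N ≤ r →
      ∫⁻ u in (Metric.closedBall x r)ᶜ, ENNReal.ofReal ‖Phi q h N (x - u)‖ ∂ν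
        ≤ ENNReal.ofReal (c * A * (N * r) ^ ((q : ℝ) - (S : ℝ)) * (1 + d / r) ^ q) := by
  obtain ⟨K, hK, hPhi⟩ := hh.exists_norm_Phi_le q S
  refine ⟨2 ^ (q + 1) * K, by positivity, fun ν A d hA hd hν N r x hN hr => ?_⟩
  have hN0 : 0 < N := by linarith
  have hr0 : 0 < r := (by positivity : 0 < 1 / N).trans_le hr
  rw [Real.rpow_sub (by positivity), Real.rpow_natCast, Real.rpow_natCast]
  set B := 2 ^ q * K * A * ((N * r) ^ q / (N * r) ^ S) * (1 + d / r) ^ q with hB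
  have hB0 : 0 ≤ B := by positivity
  let annulus (m : ℕ) : Set (Torus q) := {u | 2 ^ m * r ≤ ‖x - u‖ ∧ ‖x - u‖ < 2 ^ (m + 1) * r}
  have hnorm : Continuous fun u : Torus q => ‖x - u‖ := by fun_prop
  have hmeas (m : ℕ) : MeasurableSet (annulus m) :=
    (measurableSet_le measurable_const hnorm.measurable).inter
      (measurableSet_lt hnorm.measurable measurable_const)
  have hcover : (Metric.closedBall x r)ᶜ ⊆ ⋃ m, annulus m := by
    intro u hu
    rw [Set.mem_compl_iff, Metric.mem_closedBall', not_le, dist_eq_norm] at hu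
    obtain ⟨m, hm₁, hm₂⟩ := exists_nat_pow_near ((one_le_div hr0).2 hu.le) one_lt_two
    exact Set.mem_iUnion.2 ⟨m, (le_div_iff₀ hr0).1 hm₁, (div_lt_iff₀ hr0).1 hm₂⟩
  have hpiece (m : ℕ) : ∫⁻ u in annulus m, ENNReal.ofReal ‖Phi q h N (x - u)‖ ∂ν
      ≤ ENNReal.ofReal (B * (1 / 2) ^ m) := by
    have hsub : annulus m ⊆ Metric.closedBall x (2 ^ (m + 1) * r) := fun u hu => by
      rw [Metric.mem_closedBall', dist_eq_norm]
      exact hu.2.le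
    have hpow : ((2 : ℝ) ^ m) ^ q * 2 ^ m ≤ (2 ^ m) ^ S := by
      rw [← pow_succ]
      exact pow_le_pow_right₀ (one_le_pow₀ one_le_two) hS
    have hd' : 2 ^ (m + 1) * r + d ≤ 2 * (2 ^ m * r) * (1 + d / r) := by
      have h₁ : (1 : ℝ) ≤ 2 ^ (m + 1) := one_le_pow₀ one_le_two
      have h₂ : 2 * (2 ^ m * r) * (1 + d / r) = 2 ^ (m + 1) * r + 2 ^ (m + 1) * d := by
        field_simp
        ring
      nlinarith
    calc ∫⁻ u in annulus m, ENNReal.ofReal ‖Phi q h N (x - u)‖ ∂ν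
        ≤ ∫⁻ _ in annulus m, ENNReal.ofReal (K * N ^ q / (N * (2 ^ m * r)) ^ S) ∂ν := by
          refine setLIntegral_mono' (hmeas m) fun u hu => ENNReal.ofReal_le_ofReal ?_
          have hpos : 0 < 2 ^ m * r := by positivity
          refine (hPhi N (x - u) hN (hpos.trans_le hu.1)).trans ?_
          gcongr
          exact hu.1
      _ = ENNReal.ofReal (K * N ^ q / (N * (2 ^ m * r)) ^ S) * ν (annulus m) :=
          setLIntegral_const _ _
      _ ≤ ENNReal.ofReal (K * N ^ q / (N * (2 ^ m * r)) ^ S) *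
            ENNReal.ofReal (A * (2 ^ (m + 1) * r + d) ^ q) := by
          gcongr
          exact (measure_mono hsub).trans (hν x _ (by positivity))
      _ = ENNReal.ofReal (K * N ^ q / (N * (2 ^ m * r)) ^ S *
            (A * (2 ^ (m + 1) * r + d) ^ q)) := (ENNReal.ofReal_mul (by positivity)).symm
      _ ≤ ENNReal.ofReal (B * (1 / 2) ^ m) := by
          refine ENNReal.ofReal_le_ofReal ?_
          calc K * N ^ q / (N * (2 ^ m * r)) ^ S * (A * (2 ^ (m + 1) * r + d) ^ q)
              ≤ K * N ^ q / (N * (2 ^ m * r)) ^ S *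
                  (A * (2 * (2 ^ m * r) * (1 + d / r)) ^ q) := by gcongr
            _ = B * (((2 ^ m) ^ q * 2 ^ m) / (2 ^ m) ^ S * (1 / 2) ^ m) := by
                rw [hB, one_div, inv_pow]
                simp only [mul_pow]
                field_simp
            _ ≤ B * (1 * (1 / 2) ^ m) := by
                gcongr
                exact (div_le_one (by positivity)).2 hpow
            _ = B * (1 / 2) ^ m := by rw [one_mul]
  calc ∫⁻ u in (Metric.closedBall x r)ᶜ, ENNReal.ofReal ‖Phi q h N (x - u)‖ ∂ν
      ≤ ∫⁻ u in ⋃ m, annulus m, ENNReal.ofReal ‖Phi q h N (x - u)‖ ∂ν :=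
        lintegral_mono_set hcover
    _ ≤ ∑' m, ∫⁻ u in annulus m, ENNReal.ofReal ‖Phi q h N (x - u)‖ ∂ν :=
        lintegral_iUnion_le _ _
    _ ≤ ∑' m : ℕ, ENNReal.ofReal (B * (1 / 2) ^ m) := ENNReal.tsum_le_tsum hpiece
    _ = ENNReal.ofReal (B * 2) := by
        rw [← ENNReal.ofReal_tsum_of_nonneg (fun m => by positivity)
          (summable_geometric_two.mul_left B), tsum_mul_left, tsum_geometric_two]
    _ ≤ _ := ENNReal.ofReal_le_ofReal (le_of_eq (by rw [hB]; ring))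
end

section
/- Let f ∈ W*(𝕋) (continuously differentiable and 2π-periodic), n ≥ 1 an integer, E > 0, and T ∈ H_n^1 satisfy ‖f − T‖ ≤ E in the supremum norm on 𝕋. Then ‖f' − T'‖ ≤ c { n E + E_n(1; f') }, where c is an absolute constant. -/
open MeasureTheory Real

open scoped FourierTransform SchwartzMap

/-- There is a Schwartz function whose Fourier transform equals `1` on `[-1, 1]`. -/
lemma exists_schwartz_fourier_eq_one :
    ∃ φ : 𝓢(ℝ, ℂ), ∀ ξ : ℝ, |ξ| ≤ 1 → 𝓕 (φ : ℝ → ℂ) ξ = 1 := by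
  let b : ContDiffBump (0 : ℝ) := ⟨1, 2, one_pos, one_lt_two⟩
  have hsupp : HasCompactSupport fun x => ((b x : ℝ) : ℂ) :=
    b.hasCompactSupport.comp_left Complex.ofReal_zero
  have hsmooth : ContDiff ℝ (⊤ : ℕ∞) fun x => ((b x : ℝ) : ℂ) :=
    Complex.ofRealCLM.contDiff.comp b.contDiff
  refine ⟨𝓕⁻ (hsupp.toSchwartzMap hsmooth), fun ξ hξ => ?_⟩
  rw [← SchwartzMap.fourier_coe, FourierTransform.fourier_fourierInv_eq]
  have hb : b ξ = 1 := b.one_of_mem_closedBall (by simpa [b] using hξ)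
  simp [hb]

/-- A bounded continuous function times a Schwartz function is integrable. -/
lemma SchwartzMap.integrable_bdd_mul (φ : 𝓢(ℝ, ℂ)) {g : ℝ → ℂ} (hg : Continuous g) {C : ℝ}
    (hC : ∀ t, ‖g t‖ ≤ C) : Integrable fun s => g s * φ s :=
  φ.integrable.bdd_mul hg.aestronglyMeasurable (Filter.Eventually.of_forall hC)

lemma SchwartzMap.norm_integral_bdd_mul_le (φ : 𝓢(ℝ, ℂ)) {g : ℝ → ℂ} {C : ℝ}
    (hC : ∀ t, ‖g t‖ ≤ C) : ‖∫ s, g s * φ s‖ ≤ C * ∫ s, ‖φ s‖ := by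
  rw [← integral_const_mul]
  refine norm_integral_le_of_norm_le (φ.integrable.norm.const_mul C)
    (Filter.Eventually.of_forall fun s => ?_)
  rw [norm_mul]
  gcongr
  exact hC s

/-- Rescaled averages of a derivative against a Schwartz function, integrated by parts. -/
lemma SchwartzMap.integral_deriv_comp_mul (φ : 𝓢(ℝ, ℂ)) {u : ℝ → ℂ} (hu : ContDiff ℝ 1 u)
    {C D : ℝ} (hC : ∀ t, ‖u t‖ ≤ C) (hD : ∀ t, ‖deriv u t‖ ≤ D) {n : ℝ} (hn : n ≠ 0) (x : ℝ) :
    ∫ s, deriv u (x - s / n) * φ s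
      = n * ∫ s, u (x - s / n) * SchwartzMap.derivCLM ℂ ℂ φ s := by
  have hd : ∀ s, HasDerivAt (fun s : ℝ => u (x - s / n))
      (-(1 / (n : ℂ)) * deriv u (x - s / n)) s := by
    intro s
    have h := ((hu.differentiable one_ne_zero) (x - s / n)).hasDerivAt.scomp s
      (((hasDerivAt_id s).div_const n).const_sub x)
    simpa [Function.comp_def] using h
  have hcd : Continuous (deriv u) := hu.continuous_deriv le_rfl
  have hcu := hu.continuous
  have h1 : Integrable fun s => u (x - s / n) * SchwartzMap.derivCLM ℂ ℂ φ s :=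
    (SchwartzMap.derivCLM ℂ ℂ φ).integrable_bdd_mul (by fun_prop) fun s => hC _
  have h2 : Integrable fun s => deriv u (x - s / n) * φ s :=
    φ.integrable_bdd_mul (by fun_prop) fun s => hD _
  have h3 : Integrable fun s => u (x - s / n) * φ s :=
    φ.integrable_bdd_mul (by fun_prop) fun s => hC _
  have key := integral_mul_deriv_eq_deriv_mul_of_integrable (u := fun s => u (x - s / n)) (v := φ)
    (fun s _ => hd s) (fun s _ => φ.hasDerivAt s) h1
    (by simpa [Pi.mul_def, mul_assoc] using h2.const_mul (-(1 / (n : ℂ)))) h3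
  have hn' : (n : ℂ) ≠ 0 := by exact_mod_cast hn
  simp only [mul_assoc, integral_const_mul] at key
  simp only [SchwartzMap.derivCLM_apply, key]
  field_simp

/-- Derivatives of trigonometric polynomials of degree `< n` are of the same kind. -/
lemma trigSpan1_hasDerivAt {n : ℝ} {T : C(AddCircle (2 * π), ℂ)} (hT : T ∈ trigSpan1 n) :
    ∃ S ∈ trigSpan1 n, ∀ t : ℝ, HasDerivAt (fun s : ℝ => T (s : AddCircle (2 * π)))
      (S (t : AddCircle (2 * π))) t := by
  induction hT using Submodule.span_induction with
  | mem T h =>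
    obtain ⟨k, hk, rfl⟩ := h
    refine ⟨(2 * π * Complex.I * k / ((2 * π : ℝ) : ℂ)) • fourier k,
      Submodule.smul_mem _ _ (Submodule.subset_span ⟨k, hk, rfl⟩), fun t => ?_⟩
    simpa using hasDerivAt_fourier (2 * π) k t
  | zero => exact ⟨0, Submodule.zero_mem _, fun t => by simpa using hasDerivAt_const t (0 : ℂ)⟩
  | add T₁ T₂ _ _ h₁ h₂ =>
    obtain ⟨S₁, hS₁, h₁⟩ := h₁
    obtain ⟨S₂, hS₂, h₂⟩ := h₂
    exact ⟨S₁ + S₂, Submodule.add_mem _ hS₁ hS₂, fun t => (h₁ t).add (h₂ t)⟩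
  | smul a T _ h =>
    obtain ⟨S, hS, h⟩ := h
    exact ⟨a • S, Submodule.smul_mem _ a hS, fun t => (h t).const_smul a⟩

/-- Averages against a Schwartz function with Fourier transform `1` on `[-1, 1]` reproduce
trigonometric polynomials. -/
lemma trigSpan1_integral_eq {φ : 𝓢(ℝ, ℂ)} (hφ : ∀ ξ : ℝ, |ξ| ≤ 1 → 𝓕 (φ : ℝ → ℂ) ξ = 1)
    {n : ℝ} (hn : 0 < n) {T : C(AddCircle (2 * π), ℂ)} (hT : T ∈ trigSpan1 n) (x : ℝ) :
    ∫ s : ℝ, T ((x - s / n : ℝ) : AddCircle (2 * π)) * φ s = T (x : AddCircle (2 * π)) := by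
  have hint : ∀ T : C(AddCircle (2 * π), ℂ),
      Integrable fun s : ℝ => T ((x - s / n : ℝ) : AddCircle (2 * π)) * φ s := fun T =>
    φ.integrable_bdd_mul (T.continuous.comp
      ((AddCircle.continuous_mk' (2 * π)).comp (by fun_prop))) fun s => T.norm_coe_le_norm _
  induction hT using Submodule.span_induction with
  | mem T h =>
    obtain ⟨k, hk, rfl⟩ := h
    have hξ : |(k : ℝ) / n / (2 * π)| ≤ 1 := by
      rw [abs_div, abs_div, abs_of_pos hn, abs_of_pos Real.two_pi_pos]
      have h1 : |(k : ℝ)| / n ≤ 1 := (div_le_one hn).2 hk.le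
      have h2 : (1 : ℝ) ≤ 2 * π := by linarith [Real.pi_gt_three]
      exact (div_le_one Real.two_pi_pos).2 (h1.trans h2)
    have h := hφ _ hξ
    rw [Real.fourier_real_eq_integral_exp_smul] at h
    rw [← mul_one (fourier k (x : AddCircle (2 * π))), ← h, ← integral_const_mul]
    congr 1 with s
    have hn' : (n : ℂ) ≠ 0 := by exact_mod_cast hn.ne'
    have hpi : (π : ℂ) ≠ 0 := by exact_mod_cast Real.pi_ne_zero
    rw [fourier_coe_apply, fourier_coe_apply, smul_eq_mul, ← mul_assoc, ← Complex.exp_add]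
    congr 2
    push_cast
    field_simp
    ring
  | zero => simp
  | add T₁ T₂ _ _ h₁ h₂ =>
    simp only [ContinuousMap.add_apply, add_mul]
    rw [integral_add (hint T₁) (hint T₂), h₁, h₂]
  | smul a T _ h =>
    simp only [ContinuousMap.smul_apply, smul_eq_mul, mul_assoc]
    rw [integral_const_mul, h]

/-- Czipszer–Freud simultaneous approximation, univariate: if `f ∈ W*(𝕋)` and
`T ∈ H_n^1` with `‖f − T‖ ≤ E`, then `‖f' − T'‖ ≤ c { n E + E_n(1; f') }`. -/
theorem derivative_approx_univariate :
    ∃ c > 0, ∀ f : C(AddCircle (2 * π), ℂ),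
      ContDiff ℝ 1 (fun t : ℝ => f (t : AddCircle (2 * π))) →
      ∀ n : ℕ, 1 ≤ n → ∀ E : ℝ, 0 < E →
      ∀ T : C(AddCircle (2 * π), ℂ), T ∈ trigSpan1 (n : ℝ) → ‖f - T‖ ≤ E →
      (⨆ t : ℝ, ‖deriv (fun s : ℝ => f (s : AddCircle (2 * π))) t
          - deriv (fun s : ℝ => T (s : AddCircle (2 * π))) t‖)
        ≤ c * ((n : ℝ) * E
            + degApprox1' (n : ℝ) (deriv fun s : ℝ => f (s : AddCircle (2 * π)))) := by
  obtain ⟨φ, hφ⟩ := exists_schwartz_fourier_eq_one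
  set A : ℝ := ∫ s, ‖φ s‖
  set B : ℝ := ∫ s, ‖SchwartzMap.derivCLM ℂ ℂ φ s‖
  have hA : 0 ≤ A := integral_nonneg fun s => norm_nonneg _
  have hB : 0 ≤ B := integral_nonneg fun s => norm_nonneg _
  refine ⟨1 + A + B, by positivity, fun f hf n hn E hE T hT hfT => ?_⟩
  set F : ℝ → ℂ := fun s => f (s : AddCircle (2 * π)) with hF
  have hn0 : (0 : ℝ) < n := by exact_mod_cast hn
  have hmk := AddCircle.continuous_mk' (2 * π)
  obtain ⟨S, hS, hTS⟩ := trigSpan1_hasDerivAt hT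
  have hdT : deriv (fun s : ℝ => T (s : AddCircle (2 * π)))
      = fun t : ℝ => S (t : AddCircle (2 * π)) := funext fun t => (hTS t).deriv
  have hcS : Continuous fun t : ℝ => S (t : AddCircle (2 * π)) := S.continuous.comp hmk
  have hCT : ContDiff ℝ 1 fun s : ℝ => T (s : AddCircle (2 * π)) := by
    rw [contDiff_one_iff_deriv, hdT]
    exact ⟨fun t => (hTS t).differentiableAt, hcS⟩
  have hcF' : Continuous (deriv F) := hf.continuous_deriv le_rfl
  have hper : Function.Periodic (deriv F) (2 * π) := by
    intro t
    rw [← deriv_comp_add_const]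
    congr 1
    ext s
    simp [hF]
  obtain ⟨M, hM⟩ := (hper.compact_of_continuous Real.two_pi_pos.ne' hcF').isBounded.exists_norm_le
  replace hM : ∀ t, ‖deriv F t‖ ≤ M := fun t => hM _ ⟨t, rfl⟩
  have hdu : ∀ t, deriv (fun s : ℝ => F s - T (s : AddCircle (2 * π))) t
      = deriv F t - S (t : AddCircle (2 * π)) := fun t =>
    ((hf.differentiable one_ne_zero t).hasDerivAt.sub (hTS t)).deriv
  have hu : ∀ t : ℝ, ‖F t - T (t : AddCircle (2 * π))‖ ≤ E := fun t =>
    ((f - T).norm_coe_le_norm _).trans hfT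
  have key : ∀ Q : ↥(trigSpan1 (n : ℝ)), ∀ x : ℝ,
      ‖deriv F x - S (x : AddCircle (2 * π))‖ ≤ (1 + A + B) * ((n : ℝ) * E
        + ⨆ t : ℝ, ‖deriv F t - (Q : C(AddCircle (2 * π), ℂ)) (t : AddCircle (2 * π))‖) := by
    rintro ⟨Q, hQ⟩ x
    have hbdd : BddAbove (Set.range fun t : ℝ => ‖deriv F t - Q (t : AddCircle (2 * π))‖) := by
      refine ⟨M + ‖Q‖, ?_⟩
      rintro _ ⟨t, rfl⟩
      exact (norm_sub_le _ _).trans (add_le_add (hM t) (Q.norm_coe_le_norm _))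
    set δ : ℝ := ⨆ t : ℝ, ‖deriv F t - Q (t : AddCircle (2 * π))‖
    have hδ : ∀ t : ℝ, ‖deriv F t - Q (t : AddCircle (2 * π))‖ ≤ δ := fun t => le_ciSup hbdd t
    have hδ0 : 0 ≤ δ := (norm_nonneg _).trans (hδ 0)
    have hcQ : Continuous fun t : ℝ => Q (t : AddCircle (2 * π)) := Q.continuous.comp hmk
    have hparts := φ.integral_deriv_comp_mul (hf.sub hCT) hu
      (fun t => (congrArg norm (hdu t)).le.trans
        ((norm_sub_le _ _).trans (add_le_add (hM t) (S.norm_coe_le_norm _)))) hn0.ne' x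
    have hrep := trigSpan1_integral_eq hφ hn0 (Submodule.sub_mem _ hQ hS) x
    have hi1 : Integrable fun s : ℝ =>
        (deriv F (x - s / n) - Q ((x - s / n : ℝ) : AddCircle (2 * π))) * φ s :=
      φ.integrable_bdd_mul ((hcF'.sub hcQ).comp (by fun_prop : Continuous fun s : ℝ => x - s / n))
        fun s => hδ _
    have hi2 : Integrable fun s : ℝ => (Q - S) ((x - s / n : ℝ) : AddCircle (2 * π)) * φ s :=
      φ.integrable_bdd_mul ((Q - S).continuous.comp (hmk.comp (by fun_prop)))
        fun s => (Q - S).norm_coe_le_norm _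
    have hsplit := integral_add hi1 hi2
    rw [hrep] at hsplit
    have hdecomp : deriv F x - S (x : AddCircle (2 * π))
        = (deriv F x - Q (x : AddCircle (2 * π)))
          + (n : ℂ) * (∫ s, (F (x - s / n) - T ((x - s / n : ℝ) : AddCircle (2 * π)))
              * SchwartzMap.derivCLM ℂ ℂ φ s)
          - ∫ s, (deriv F (x - s / n) - Q ((x - s / n : ℝ) : AddCircle (2 * π))) * φ s := by
      rw [← Complex.ofReal_natCast, ← hparts]
      have hcongr : ∀ s : ℝ, deriv (fun s : ℝ => F s - T (s : AddCircle (2 * π))) (x - s / n) * φ s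
          = (deriv F (x - s / n) - Q ((x - s / n : ℝ) : AddCircle (2 * π))) * φ s
            + (Q - S) ((x - s / n : ℝ) : AddCircle (2 * π)) * φ s := fun s => by
        rw [hdu, ContinuousMap.sub_apply]
        ring
      rw [integral_congr_ae (Filter.Eventually.of_forall hcongr), hsplit,
        ContinuousMap.sub_apply]
      ring
    have hb1 := (SchwartzMap.derivCLM ℂ ℂ φ).norm_integral_bdd_mul_le fun s => hu (x - s / n)
    have hb2 := φ.norm_integral_bdd_mul_le fun s => hδ (x - s / n)
    rw [hdecomp]
    refine (norm_sub_le _ _).trans ((add_le_add ((norm_add_le _ _).trans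
      (add_le_add (hδ x) ?_)) hb2).trans (b := δ + n * (E * B) + δ * A) ?_)
    · rw [norm_mul, Complex.norm_natCast]
      gcongr
    · have h1 : 0 ≤ (n : ℝ) * E := by positivity
      nlinarith [mul_nonneg h1 hA, mul_nonneg hδ0 hB]
  have hc : 0 < 1 + A + B := by positivity
  rw [hdT]
  refine ciSup_le fun x => ?_
  have h : ‖deriv F x - S (x : AddCircle (2 * π))‖ / (1 + A + B) - n * E
      ≤ degApprox1' (n : ℝ) (deriv F) :=
    le_ciInf fun Q => by
      rw [sub_le_iff_le_add', div_le_iff₀' hc]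
      exact key Q x
  rwa [sub_le_iff_le_add', div_le_iff₀' hc] at h
end

section
/- Let f ∈ W*(𝕋^q), N ≥ 1 an integer, E > 0, and T ∈ H_N^q satisfy ‖f − T‖ ≤ E. Then ‖f − T‖_{W*} ≤ c { N E + Σ_{j=1}^q E_N(q; D_j f) }, and in particular ‖T‖_{W*} ≤ c N { E + (1/N) ‖f‖_{W*} }, where c depends only on q. -/
open MeasureTheory Real

open scoped SchwartzMap FourierTransform LineDeriv

theorem SchwartzMap.exists_fourier_eq_one_on_unit_ball (V : Type*) [NormedAddCommGroup V]
    [InnerProductSpace ℝ V] [FiniteDimensional ℝ V] [MeasurableSpace V] [BorelSpace V] :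
    ∃ K : 𝓢(V, ℂ), ∀ w : V, ‖w‖ ≤ 1 → 𝓕 (K : V → ℂ) w = 1 := by
  let b : ContDiffBump (0 : V) := ⟨1, 2, one_pos, one_lt_two⟩
  have hs : HasCompactSupport (fun x => (b x : ℂ)) :=
    b.hasCompactSupport.comp_left Complex.ofReal_zero
  have hd : ContDiff ℝ (⊤ : ℕ∞) (fun x => (b x : ℂ)) := Complex.ofRealCLM.contDiff.comp b.contDiff
  refine ⟨𝓕⁻ (hs.toSchwartzMap hd), fun w hw => ?_⟩
  rw [← SchwartzMap.fourier_coe, FourierTransform.fourier_fourierInv_eq]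
  have : b w = 1 := b.one_of_mem_closedBall (by simpa [b] using hw)
  simp [this]

section TorusLift

variable {q : ℕ}

theorem continuous_projT : Continuous (projT : (Fin q → ℝ) → Torus q) :=
  continuous_pi fun j => (AddCircle.continuous_mk' (2 * π)).comp (continuous_apply j)

theorem continuous_liftT (f : C(Torus q, ℂ)) : Continuous (liftT f) :=
  f.continuous.comp continuous_projT

theorem norm_liftT_le (f : C(Torus q, ℂ)) (x : Fin q → ℝ) : ‖liftT f x‖ ≤ ‖f‖ :=
  f.norm_coe_le_norm _

theorem projT_add (x y : Fin q → ℝ) : projT (x + y) = projT x + projT y := rfl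

theorem exists_mem_Icc_projT_eq (x : Fin q → ℝ) :
    ∃ y ∈ Set.Icc (0 : Fin q → ℝ) (fun _ => 2 * π), projT y = projT x := by
  have h (j : Fin q) : ∃ t ∈ Set.Icc (0 : ℝ) (0 + 2 * π),
      (t : AddCircle (2 * π)) = (x j : AddCircle (2 * π)) := by
    have := AddCircle.coe_image_Icc_eq (2 * π) (0 : ℝ)
    have hx : (x j : AddCircle (2 * π)) ∈ (Set.univ : Set (AddCircle (2 * π))) := trivial
    rwa [← this] at hx
  choose y hy hyx using h
  exact ⟨y, ⟨fun j => (hy j).1, fun j => by simpa using (hy j).2⟩, funext hyx⟩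

theorem fderiv_liftT_eq_of_projT_eq (f : C(Torus q, ℂ)) {x y : Fin q → ℝ}
    (h : projT x = projT y) : fderiv ℝ (liftT f) x = fderiv ℝ (liftT f) y := by
  have hper : (fun z => liftT f (z + (x - y))) = liftT f := by
    funext z
    have : projT (x - y) = 0 := by
      funext j
      have := congrFun h j
      simpa [projT, sub_eq_zero] using this
    simp [liftT, projT_add, this]
  have := fderiv_comp_add_right (𝕜 := ℝ) (f := liftT f) (x := y) (x - y)
  rw [hper] at this
  rw [this]
  congr 1
  abel

theorem MemW.continuous_fderiv_apply {f : C(Torus q, ℂ)} (hf : MemW f) (v : Fin q → ℝ) :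
    Continuous fun x => fderiv ℝ (liftT f) x v :=
  (ContDiff.continuous_fderiv hf one_ne_zero).clm_apply continuous_const

theorem MemW.exists_norm_fderiv_apply_le {f : C(Torus q, ℂ)} (hf : MemW f) (v : Fin q → ℝ) :
    ∃ C, ∀ x, ‖fderiv ℝ (liftT f) x v‖ ≤ C := by
  obtain ⟨C, hC⟩ := (isCompact_Icc (a := (0 : Fin q → ℝ))
    (b := fun _ => 2 * π)).exists_bound_of_continuousOn (hf.continuous_fderiv_apply v).continuousOn
  refine ⟨C, fun x => ?_⟩
  obtain ⟨y, hy, hyx⟩ := exists_mem_Icc_projT_eq x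
  rw [← fderiv_liftT_eq_of_projT_eq f hyx]
  exact hC y hy

theorem MemW.bddAbove_norm_fderiv_apply {f : C(Torus q, ℂ)} (hf : MemW f) (v : Fin q → ℝ) :
    BddAbove (Set.range fun x => ‖fderiv ℝ (liftT f) x v‖) := by
  obtain ⟨C, hC⟩ := hf.exists_norm_fderiv_apply_le v
  exact ⟨C, Set.forall_mem_range.2 hC⟩

theorem MemW.sub {f g : C(Torus q, ℂ)} (hf : MemW f) (hg : MemW g) : MemW (f - g) :=
  ContDiff.sub hf hg

theorem MemW.fderiv_sub {f g : C(Torus q, ℂ)} (hf : MemW f) (hg : MemW g) (x : Fin q → ℝ) :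
    fderiv ℝ (liftT (f - g)) x = fderiv ℝ (liftT f) x - fderiv ℝ (liftT g) x :=
  _root_.fderiv_sub (hf.differentiable one_ne_zero x) (hg.differentiable one_ne_zero x)

theorem liftT_eK (k : Fin q → ℤ) (x : Fin q → ℝ) :
    liftT (eK k) x = Complex.exp (Complex.I * ∑ j, (k j : ℂ) * (x j : ℂ)) := by
  have hpi : (π : ℂ) ≠ 0 := Complex.ofReal_ne_zero.2 Real.pi_ne_zero
  simp only [liftT, eK, projT, ContinuousMap.coe_mk, fourier_coe_apply, ← Complex.exp_sum,
    Finset.mul_sum]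
  congr 1
  refine Finset.sum_congr rfl fun j _ => ?_
  push_cast
  field_simp

theorem liftT_eK_eq (k : Fin q → ℤ) :
    liftT (eK k) = fun x => Complex.exp (Complex.I * ∑ j, (k j : ℂ) * (x j : ℂ)) :=
  funext (liftT_eK k)

theorem fderiv_liftT_eK_apply_single (k : Fin q → ℤ) (x : Fin q → ℝ) (j : Fin q) :
    fderiv ℝ (liftT (eK k)) x (Pi.single j 1) = (Complex.I * k j) * liftT (eK k) x := by
  have hL : HasFDerivAt (fun x : Fin q → ℝ => ∑ j, (k j : ℂ) * (x j : ℂ))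
      (∑ j, (k j : ℂ) •
        (Complex.ofRealCLM.comp (ContinuousLinearMap.proj (R := ℝ) (φ := fun _ => ℝ) j))) x :=
    HasFDerivAt.fun_sum fun j _ => ((Complex.ofRealCLM.comp
      (ContinuousLinearMap.proj (R := ℝ) (φ := fun _ => ℝ) j)).hasFDerivAt).const_mul _
  rw [liftT_eK_eq, ((hL.const_mul Complex.I).cexp).fderiv]
  have hsum : ∑ i, (k i : ℂ) * ((Pi.single j (1 : ℝ) : Fin q → ℝ) i : ℂ) = k j := by
    rw [Finset.sum_eq_single j (fun i _ hi => by simp [hi]) (by simp)]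
    simp
  simp [hsum]
  ring

theorem memW_of_mem_trigSpan {n : ℝ} {P : C(Torus q, ℂ)} (hP : P ∈ trigSpan q n) : MemW P := by
  refine Submodule.span_induction ?_ ?_ ?_ ?_ hP
  · rintro _ ⟨k, -, rfl⟩
    rw [MemW, liftT_eK_eq]
    exact (contDiff_const.mul (ContDiff.sum fun j _ => contDiff_const.mul
      (Complex.ofRealCLM.contDiff.comp (contDiff_apply ℝ ℝ j)))).cexp
  · exact contDiff_const
  · intro f g _ _ hf hg
    exact ContDiff.add hf hg
  · intro a f _ hf
    exact contDiff_const.smul hf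

theorem exists_mem_trigSpan_fderiv_eq {n : ℝ} {P : C(Torus q, ℂ)} (hP : P ∈ trigSpan q n)
    (j : Fin q) :
    ∃ Q ∈ trigSpan q n, ∀ x, fderiv ℝ (liftT P) x (Pi.single j 1) = Q (projT x) := by
  induction hP using Submodule.span_induction with
  | mem P h =>
    obtain ⟨k, hk, rfl⟩ := h
    refine ⟨(Complex.I * k j) • eK k,
      Submodule.smul_mem _ _ (Submodule.subset_span ⟨k, hk, rfl⟩), fun x => ?_⟩
    exact fderiv_liftT_eK_apply_single k x j
  | zero =>
    refine ⟨0, Submodule.zero_mem _, fun x => ?_⟩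
    have : liftT (0 : C(Torus q, ℂ)) = fun _ => 0 := rfl
    simp [this]
  | add f g hf hg ihf ihg =>
    obtain ⟨Qf, hQf, hf'⟩ := ihf
    obtain ⟨Qg, hQg, hg'⟩ := ihg
    refine ⟨Qf + Qg, Submodule.add_mem _ hQf hQg, fun x => ?_⟩
    have : liftT (f + g) = liftT f + liftT g := rfl
    rw [this, fderiv_add ((memW_of_mem_trigSpan hf).differentiable one_ne_zero x)
      ((memW_of_mem_trigSpan hg).differentiable one_ne_zero x)]
    simp [hf', hg']
  | smul a f hf ih =>
    obtain ⟨Q, hQ, hf'⟩ := ih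
    refine ⟨a • Q, Submodule.smul_mem _ _ hQ, fun x => ?_⟩
    have : liftT (a • f) = a • liftT f := rfl
    rw [this, fderiv_const_smul ((memW_of_mem_trigSpan hf).differentiable one_ne_zero x)]
    simp [hf']

end TorusLift

section Averaging

variable {q : ℕ}

theorem SchwartzMap.integrable_mul_of_norm_le (K : 𝓢(EuclideanSpace ℝ (Fin q), ℂ))
    {G : EuclideanSpace ℝ (Fin q) → ℂ} (hG : Continuous G) {M : ℝ} (hM : ∀ t, ‖G t‖ ≤ M) :
    Integrable fun t => K t * G t :=
  K.integrable.mul_bdd (c := M) hG.aestronglyMeasurable (Filter.Eventually.of_forall hM)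

theorem SchwartzMap.norm_integral_mul_le (K : 𝓢(EuclideanSpace ℝ (Fin q), ℂ))
    {G : EuclideanSpace ℝ (Fin q) → ℂ} {M : ℝ} (hM : ∀ t, ‖G t‖ ≤ M) :
    ‖∫ t, K t * G t‖ ≤ (∫ t, ‖K t‖) * M := by
  rw [← integral_mul_const]
  refine norm_integral_le_of_norm_le (K.integrable.norm.mul_const M)
    (Filter.Eventually.of_forall fun t => ?_)
  rw [norm_mul]
  gcongr
  exact hM t

theorem continuous_sub_smul_ofLp (x : Fin q → ℝ) (r : ℝ) :
    Continuous fun t : EuclideanSpace ℝ (Fin q) => x - r • t.ofLp := by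
  fun_prop

theorem integral_mul_trigSpan_eq {K : 𝓢(EuclideanSpace ℝ (Fin q), ℂ)}
    (hK : ∀ w, ‖w‖ ≤ 1 → 𝓕 (K : EuclideanSpace ℝ (Fin q) → ℂ) w = 1) {N : ℝ} (hN : 0 < N)
    {P : C(Torus q, ℂ)} (hP : P ∈ trigSpan q N) (x : Fin q → ℝ) :
    ∫ t, K t * liftT P (x - N⁻¹ • t.ofLp) = liftT P x := by
  have hint (f : C(Torus q, ℂ)) : Integrable fun t => K t * liftT f (x - N⁻¹ • t.ofLp) :=
    K.integrable_mul_of_norm_le ((continuous_liftT f).comp (continuous_sub_smul_ofLp x _))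
      fun t => norm_liftT_le f _
  induction hP using Submodule.span_induction with
  | mem P h =>
    obtain ⟨k, hk, rfl⟩ := h
    let w : EuclideanSpace ℝ (Fin q) := WithLp.toLp 2 fun j => (2 * π * N)⁻¹ * k j
    have hw : ‖w‖ ≤ 1 := by
      have hwk : w = (2 * π * N)⁻¹ • (WithLp.toLp 2 fun j => (k j : ℝ) : EuclideanSpace ℝ (Fin q)) :=
        rfl
      have hk' : ‖(WithLp.toLp 2 fun j => (k j : ℝ) : EuclideanSpace ℝ (Fin q))‖ = l2 k := by
        simp [EuclideanSpace.norm_eq, l2]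
      have hpi := Real.pi_gt_three
      rw [hwk, norm_smul, hk', Real.norm_of_nonneg (by positivity), inv_mul_le_iff₀ (by positivity)]
      nlinarith
    rw [← one_mul (liftT (eK k) x), ← hK w hw, Real.fourier_eq', ← integral_mul_const]
    refine integral_congr_ae (Filter.Eventually.of_forall fun t => ?_)
    have hE : liftT (eK k) (x - N⁻¹ • t.ofLp) =
        Complex.exp (↑(-2 * π * inner ℝ t w) * Complex.I) * liftT (eK k) x := by
      rw [liftT_eK, liftT_eK, ← Complex.exp_add]
      congr 1
      simp only [PiLp.inner_apply, w, Pi.sub_apply, Pi.smul_apply, smul_eq_mul]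
      push_cast
      simp only [mul_sub, Finset.sum_sub_distrib, Finset.mul_sum, Finset.sum_mul]
      rw [sub_eq_neg_add, ← Finset.sum_neg_distrib]
      congr 1
      refine Finset.sum_congr rfl fun j _ => ?_
      have hN' : (N : ℂ) ≠ 0 := Complex.ofReal_ne_zero.2 hN.ne'
      have hpi : (π : ℂ) ≠ 0 := Complex.ofReal_ne_zero.2 Real.pi_ne_zero
      simp
      field_simp
    simp only [hE, smul_eq_mul]
    ring
  | zero => simp [liftT]
  | add f g hf hg ihf ihg =>
    have : ∀ y, liftT (f + g) y = liftT f y + liftT g y := fun _ => rfl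
    simp only [this, mul_add]
    rw [integral_add (hint f) (hint g), ihf, ihg]
  | smul a f hf ih =>
    have : ∀ y, liftT (a • f) y = a * liftT f y := fun _ => rfl
    simp only [this, mul_left_comm _ a]
    rw [integral_const_mul, ih]

theorem MemW.norm_integral_mul_fderiv_le (K : 𝓢(EuclideanSpace ℝ (Fin q), ℂ)) {N : ℝ} (hN : 0 < N)
    {g : C(Torus q, ℂ)} (hg : MemW g) (x : Fin q → ℝ) (j : Fin q) :
    ‖∫ t, K t * fderiv ℝ (liftT g) (x - N⁻¹ • t.ofLp) (Pi.single j 1)‖ ≤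
      N * ((∫ t, ‖(∂_{EuclideanSpace.single j (1 : ℝ)} K) t‖) * ‖g‖) := by
  set v : EuclideanSpace ℝ (Fin q) := EuclideanSpace.single j 1 with hv
  let L : EuclideanSpace ℝ (Fin q) →L[ℝ] (Fin q → ℝ) :=
    (EuclideanSpace.equiv (Fin q) ℝ).toContinuousLinearMap
  have hgd : Differentiable ℝ (liftT g) := ContDiff.differentiable hg one_ne_zero
  have hφ (t) : HasFDerivAt (fun t : EuclideanSpace ℝ (Fin q) => x - N⁻¹ • t.ofLp)
      (-(N⁻¹ • L)) t := ((L.hasFDerivAt (x := t)).const_smul N⁻¹).const_sub x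
  have hd (t) := (hgd _).hasFDerivAt.comp t (hφ t)
  have hdv (t) : fderiv ℝ (liftT g ∘ fun t : EuclideanSpace ℝ (Fin q) => x - N⁻¹ • t.ofLp) t v =
      -((N⁻¹ : ℝ) : ℂ) * fderiv ℝ (liftT g) (x - N⁻¹ • t.ofLp) (Pi.single j 1) := by
    have hLv : L v = Pi.single j 1 := by
      ext i; simp [L, hv, Pi.single_apply]
    rw [(hd t).fderiv]
    simp [hLv]
  obtain ⟨C, hC⟩ := hg.exists_norm_fderiv_apply_le (Pi.single j 1)
  have hcont := continuous_sub_smul_ofLp x N⁻¹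
  have hint : Integrable fun t =>
      K t * fderiv ℝ (liftT g) (x - N⁻¹ • t.ofLp) (Pi.single j 1) :=
    K.integrable_mul_of_norm_le ((hg.continuous_fderiv_apply _).comp hcont) fun t => hC _
  have hparts := integral_mul_fderiv_eq_neg_fderiv_mul_of_integrable (μ := volume) (v := v)
    (f := K) (g := liftT g ∘ fun t : EuclideanSpace ℝ (Fin q) => x - N⁻¹ • t.ofLp)
    ((∂_{v} K).integrable_mul_of_norm_le ((continuous_liftT g).comp hcont)
      fun t => norm_liftT_le g _)
    (by simpa only [hdv, mul_left_comm] using hint.const_mul _)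
    (K.integrable_mul_of_norm_le ((continuous_liftT g).comp hcont) fun t => norm_liftT_le g _)
    (fun t _ => K.differentiableAt) (fun t _ => (hd t).differentiableAt)
  simp only [hdv, mul_left_comm (K _)] at hparts
  rw [integral_const_mul] at hparts
  have hbound := (∂_{v} K).norm_integral_mul_le
    (fun t : EuclideanSpace ℝ (Fin q) => norm_liftT_le g (x - N⁻¹ • t.ofLp))
  have hnorm := congrArg norm hparts
  rw [norm_mul, norm_neg, norm_neg, Complex.norm_real, norm_inv, Real.norm_of_nonneg hN.le] at hnorm
  rw [inv_mul_eq_iff_eq_mul₀ hN.ne'] at hnorm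
  rw [hnorm]
  exact mul_le_mul_of_nonneg_left hbound hN.le

theorem norm_fderiv_sub_apply_le {K : 𝓢(EuclideanSpace ℝ (Fin q), ℂ)}
    (hK : ∀ w, ‖w‖ ≤ 1 → 𝓕 (K : EuclideanSpace ℝ (Fin q) → ℂ) w = 1) {N : ℝ} (hN : 0 < N)
    {f T : C(Torus q, ℂ)} (hf : MemW f) (hT : T ∈ trigSpan q N) (j : Fin q) (x : Fin q → ℝ) :
    ‖fderiv ℝ (liftT (f - T)) x (Pi.single j 1)‖ ≤
      N * ((∫ t, ‖(∂_{EuclideanSpace.single j (1 : ℝ)} K) t‖) * ‖f - T‖) +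
      (1 + ∫ t, ‖K t‖) *
        degApprox' q N fun x => fderiv ℝ (liftT f) x (Pi.single j 1) := by
  have hTW := memW_of_mem_trigSpan hT
  have hA : 0 < 1 + ∫ t, ‖K t‖ := by positivity
  rw [← sub_le_iff_le_add', ← div_le_iff₀' hA]
  refine le_ciInf fun P => ?_
  rw [div_le_iff₀' hA, sub_le_iff_le_add']
  obtain ⟨Q, hQ, hQT⟩ := exists_mem_trigSpan_fderiv_eq hT j
  obtain ⟨C, hC⟩ := hf.exists_norm_fderiv_apply_le (Pi.single j 1)
  set R : (Fin q → ℝ) → ℂ := fun y => fderiv ℝ (liftT f) y (Pi.single j 1) - liftT P y with hR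
  have hRC (y) : ‖R y‖ ≤ C + ‖(P : C(Torus q, ℂ))‖ :=
    (norm_sub_le _ _).trans (add_le_add (hC y) (norm_liftT_le _ y))
  have hRM (y) : ‖R y‖ ≤ ⨆ y, ‖R y‖ := le_ciSup ⟨_, Set.forall_mem_range.2 hRC⟩ y
  have hRc : Continuous R := (hf.continuous_fderiv_apply _).sub (continuous_liftT _)
  have hcont := continuous_sub_smul_ofLp x N⁻¹
  set D : C(Torus q, ℂ) := P - Q with hD
  have hDS : D ∈ trigSpan q N := Submodule.sub_mem _ P.2 hQ
  have hsplit (y) : fderiv ℝ (liftT (f - T)) y (Pi.single j 1) = R y + liftT D y := by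
    rw [hf.fderiv_sub hTW]
    simp only [sub_apply, hQT, hR, hD, liftT, ContinuousMap.sub_apply]
    ring
  have hint : ∫ t, K t * fderiv ℝ (liftT (f - T)) (x - N⁻¹ • t.ofLp) (Pi.single j 1) =
      (∫ t, K t * R (x - N⁻¹ • t.ofLp)) + liftT D x := by
    simp only [hsplit, mul_add]
    rw [integral_add (K.integrable_mul_of_norm_le (G := fun t => R (x - N⁻¹ • t.ofLp)) (hRc.comp hcont)
        fun t => hRC _)
      (K.integrable_mul_of_norm_le (G := fun t => liftT D (x - N⁻¹ • t.ofLp))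
        ((continuous_liftT D).comp hcont) fun t => norm_liftT_le D _),
      integral_mul_trigSpan_eq hK hN hDS]
  have hx : fderiv ℝ (liftT (f - T)) x (Pi.single j 1) =
      (∫ t, K t * fderiv ℝ (liftT (f - T)) (x - N⁻¹ • t.ofLp) (Pi.single j 1)) +
        (R x - ∫ t, K t * R (x - N⁻¹ • t.ofLp)) := by
    rw [hint, hsplit]; ring
  rw [hx]
  refine (norm_add_le _ _).trans (add_le_add
    (MemW.norm_integral_mul_fderiv_le K hN (hf.sub hTW) x j) ((norm_sub_le _ _).trans ?_))
  rw [add_mul, one_mul]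
  exact add_le_add (hRM x) (K.norm_integral_mul_le fun t => hRM _)

end Averaging

theorem degApprox'_nonneg (q : ℕ) (n : ℝ) (g : (Fin q → ℝ) → ℂ) : 0 ≤ degApprox' q n g :=
  Real.iInf_nonneg fun _ => Real.iSup_nonneg fun _ => norm_nonneg _

theorem degApprox'_le_iSup_norm (q : ℕ) (n : ℝ) (g : (Fin q → ℝ) → ℂ) :
    degApprox' q n g ≤ ⨆ x, ‖g x‖ := by
  have hb : BddBelow (Set.range fun T : ↥(trigSpan q n) =>
      ⨆ x : Fin q → ℝ, ‖g x - (T : C(Torus q, ℂ)) (projT x)‖) :=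
    ⟨0, Set.forall_mem_range.2 fun _ => Real.iSup_nonneg fun _ => norm_nonneg _⟩
  exact (ciInf_le hb 0).trans_eq (by simp)

theorem Wnorm_le_Wnorm_add_Wnorm_sub {q : ℕ} {f T : C(Torus q, ℂ)} (hf : MemW f) (hT : MemW T) :
    Wnorm T ≤ Wnorm f + Wnorm (f - T) := by
  rw [Wnorm, Wnorm, Wnorm, ← Finset.sum_add_distrib]
  refine Finset.sum_le_sum fun j _ => ciSup_le fun x => ?_
  have h : fderiv ℝ (liftT T) x (Pi.single j 1) = fderiv ℝ (liftT f) x (Pi.single j 1) -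
      fderiv ℝ (liftT (f - T)) x (Pi.single j 1) := by
    rw [hf.fderiv_sub hT]; simp
  rw [h]
  exact (norm_sub_le _ _).trans (add_le_add (le_ciSup (hf.bddAbove_norm_fderiv_apply _) x)
    (le_ciSup ((hf.sub hT).bddAbove_norm_fderiv_apply _) x))

/-- simultaneous approximation, multivariate: if `f ∈ W*(𝕋^q)` and `T ∈ H_N^q`
with `‖f − T‖ ≤ E`, then `‖f − T‖_{W*} ≤ c { N E + Σ_j E_N(q; D_j f) }`, and in particular
`‖T‖_{W*} ≤ c N { E + (1/N) ‖f‖_{W*} }`. -/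
theorem derivative_approx_multivariate (q : ℕ) :
    ∃ c > 0, ∀ f : C(Torus q, ℂ), MemW f →
      ∀ N : ℕ, 1 ≤ N → ∀ E : ℝ, 0 < E →
      ∀ T : C(Torus q, ℂ), T ∈ trigSpan q (N : ℝ) → ‖f - T‖ ≤ E →
      Wnorm (f - T) ≤ c * ((N : ℝ) * E
          + ∑ j, degApprox' q (N : ℝ) fun x => fderiv ℝ (liftT f) x (Pi.single j 1)) ∧
      Wnorm T ≤ c * (N : ℝ) * (E + (1 / (N : ℝ)) * Wnorm f) := by
  obtain ⟨K, hK⟩ := SchwartzMap.exists_fourier_eq_one_on_unit_ball (EuclideanSpace ℝ (Fin q))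
  let A : ℝ := ∫ t, ‖K t‖
  let B : ℝ := ∑ j : Fin q, ∫ t, ‖(∂_{EuclideanSpace.single j (1 : ℝ)} K) t‖
  have hA : 0 ≤ A := by positivity
  have hB : 0 ≤ B := by positivity
  refine ⟨A + B + 2, by positivity, fun f hf N hN E hE T hT hfT => ?_⟩
  have hN0 : (0 : ℝ) < N := by exact_mod_cast hN
  have hTW := memW_of_mem_trigSpan hT
  set S : ℝ := ∑ j, degApprox' q (N : ℝ) fun x => fderiv ℝ (liftT f) x (Pi.single j 1) with hS
  have hS0 : 0 ≤ S := Finset.sum_nonneg fun j _ => degApprox'_nonneg _ _ _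
  have hSW : S ≤ Wnorm f := Finset.sum_le_sum fun j _ => degApprox'_le_iSup_norm _ _ _
  have hmain : Wnorm (f - T) ≤ B * (N * E) + (1 + A) * S := by
    rw [hS, Finset.mul_sum, Finset.sum_mul, ← Finset.sum_add_distrib]
    refine Finset.sum_le_sum fun j _ => ciSup_le fun x =>
      (norm_fderiv_sub_apply_le hK hN0 hf hT j x).trans (add_le_add_left ?_ _)
    rw [mul_left_comm]
    gcongr
  have hNE : 0 < N * E := mul_pos hN0 hE
  constructor
  · nlinarith [mul_nonneg hA hNE.le, mul_nonneg hB hS0]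
  · have h := Wnorm_le_Wnorm_add_Wnorm_sub hf hTW
    have hW : 0 ≤ Wnorm f := hS0.trans hSW
    have hrw : (A + B + 2) * (N : ℝ) * (E + 1 / (N : ℝ) * Wnorm f) =
        (A + B + 2) * (N * E + Wnorm f) := by
      field_simp
    rw [hrw]
    nlinarith [mul_nonneg hA hNE.le, mul_nonneg hB hW,
      mul_le_mul_of_nonneg_left hSW (add_nonneg zero_le_one hA)]
end

section
/- If f ∈ W*(𝕋^q), then for every N ≥ 1, E_N(q; f) ≤ (c/N) ‖f‖_{W*}, where c depends only on q. -/
open MeasureTheory Real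

/-! ### A positive trigonometric kernel on the circle -/

lemma exists_coe_eq_abs_eq_norm (x : AddCircle (2 * π)) :
    ∃ t : ℝ, (t : AddCircle (2 * π)) = x ∧ |t| = ‖x‖ := by
  obtain ⟨s, rfl⟩ := QuotientAddGroup.mk_surjective x
  refine ⟨s - round ((2 * π)⁻¹ * s) * (2 * π), ?_, (AddCircle.norm_eq _).symm⟩
  rw [AddCircle.coe_sub, ← zsmul_eq_mul, AddCircle.coe_zsmul, AddCircle.coe_period, smul_zero,
    sub_zero]

lemma norm_sq_le_one_sub_re_fourier (x : AddCircle (2 * π)) :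
    ‖x‖ ^ 2 ≤ π ^ 2 / 2 * (1 - (fourier 1 x : ℂ).re) := by
  obtain ⟨t, rfl, ht⟩ := exists_coe_eq_abs_eq_norm x
  have hle := AddCircle.norm_le_half_period (2 * π) (x := (t : AddCircle (2 * π)))
    two_pi_pos.ne'
  rw [← ht, abs_of_pos two_pi_pos, mul_div_cancel_left₀ π two_ne_zero] at hle
  have hre : (fourier 1 (t : AddCircle (2 * π)) : ℂ).re = cos t := by
    have : (π : ℂ) ≠ 0 := by exact_mod_cast pi_ne_zero
    rw [fourier_coe_apply, ← Complex.exp_ofReal_mul_I_re]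
    congr 2
    push_cast
    field_simp
  have hcos := cos_le_one_sub_mul_cos_sq hle
  rw [← ht, sq_abs, hre]
  calc t ^ 2 = π ^ 2 / 2 * (2 / π ^ 2 * t ^ 2) := by field_simp
    _ ≤ π ^ 2 / 2 * (1 - cos t) := by gcongr; linarith

/-- The equidistributed points `2πl/P` of the circle. -/
noncomputable def equiNode (P l : ℕ) : AddCircle (2 * π) := ((2 * π * l / P : ℝ) : AddCircle (2 * π))

lemma sum_fourier_sub_equiNode {P : ℕ} (d : ℤ) (hd : |d| < P) (x : AddCircle (2 * π)) :
    ∑ l : Fin P, (fourier d (x - equiNode P l) : ℂ) = if d = 0 then (P : ℂ) else 0 := by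
  split_ifs with h
  · simp [h]
  have hP : (P : ℂ) ≠ 0 := by
    rintro h0
    have : P = 0 := by exact_mod_cast h0
    subst this
    have := abs_nonneg d
    simp at hd
    omega
  have key : ∀ l : ℕ, (fourier d (x - equiNode P l) : ℂ)
      = fourier d x * Complex.exp (-(2 * π * Complex.I * d / P)) ^ l := by
    intro l
    rw [sub_eq_add_neg, fourier_apply, smul_add, AddCircle.toCircle_add, Circle.coe_mul,
      ← fourier_apply, ← fourier_apply, ← Complex.exp_nat_mul, equiNode, ← AddCircle.coe_neg,
      fourier_coe_apply]
    congr 2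
    push_cast
    have : (π : ℂ) ≠ 0 := by exact_mod_cast pi_ne_zero
    field_simp
  rw [Fin.sum_univ_eq_sum_range (fun l => (fourier d (x - equiNode P l) : ℂ)),
    Finset.sum_congr rfl fun l _ => key l, ← Finset.mul_sum, geom_sum_eq]
  · rw [← Complex.exp_nat_mul]
    have : Complex.exp (P * -(2 * π * Complex.I * d / P)) = 1 := by
      rw [Complex.exp_eq_one_iff]
      refine ⟨-d, ?_⟩
      push_cast
      field_simp
    rw [this, sub_self, zero_div, mul_zero]
  · intro h1
    obtain ⟨n, hn⟩ := Complex.exp_eq_one_iff.1 h1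
    have h2 : (d : ℂ) = -n * P := by
      have : (π : ℂ) ≠ 0 := by exact_mod_cast pi_ne_zero
      field_simp at hn
      have := Complex.I_ne_zero
      linear_combination (-1) * hn
    have h3 : d = -n * P := by exact_mod_cast h2
    rcases eq_or_ne n 0 with rfl | h0
    · simp at h3; exact h h3
    · rw [h3, abs_mul, abs_neg, Nat.abs_cast] at hd
      have := Int.one_le_abs h0
      nlinarith [Int.natCast_nonneg P]

/-- The coefficients `sin (π (j + 1) / (M + 1))` of the Fejér–Korovkin kernel. -/
noncomputable def korovkinCoeff (M j : ℕ) : ℝ := sin (π / (M + 1) * (j + 1))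

lemma korovkinCoeff_self (M : ℕ) : korovkinCoeff M M = 0 := by
  have : π / (M + 1) * (M + 1 : ℝ) = π := by field_simp
  rw [korovkinCoeff, this, sin_pi]

lemma sum_korovkinCoeff_sq_pos {M : ℕ} (hM : 1 ≤ M) :
    0 < ∑ j : Fin M, korovkinCoeff M j ^ 2 := by
  refine Finset.sum_pos (fun j _ => ?_) ⟨⟨0, hM⟩, Finset.mem_univ _⟩
  have hj : (j : ℝ) + 1 < M + 1 := by exact_mod_cast Nat.succ_lt_succ j.2
  have : 0 < korovkinCoeff M j := by
    refine sin_pos_of_pos_of_lt_pi (by positivity) ?_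
    rw [div_mul_eq_mul_div, div_lt_iff₀ (by positivity)]
    exact mul_lt_mul_of_pos_left hj pi_pos
  positivity

lemma sum_korovkinCoeff_mul_succ (M : ℕ) :
    ∑ j : Fin M, korovkinCoeff M j * korovkinCoeff M (j + 1)
      = cos (π / (M + 1)) * ∑ j : Fin M, korovkinCoeff M j ^ 2 := by
  set θ : ℝ := π / (M + 1) with hθ
  let g : ℕ → ℝ := fun j => sin (θ * j) * sin (θ * (j + 1))
  have tele := Finset.sum_range_sub g M
  have hg0 : g 0 = 0 := by simp [g]
  have hgM : g M = 0 := by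
    have := korovkinCoeff_self M
    simp only [korovkinCoeff, ← hθ] at this
    simp [g, this]
  rw [Fin.sum_univ_eq_sum_range (fun j => korovkinCoeff M j * korovkinCoeff M (j + 1)),
    Fin.sum_univ_eq_sum_range (fun j => korovkinCoeff M j ^ 2), Finset.mul_sum,
    ← sub_eq_zero, ← Finset.sum_sub_distrib]
  have : ∀ j ∈ Finset.range M, korovkinCoeff M j * korovkinCoeff M (j + 1)
      - cos θ * korovkinCoeff M j ^ 2 = 1 / 2 * (g (j + 1) - g j) := by
    intro j _
    have e1 : θ * ((j + 1 : ℕ) + 1 : ℝ) = θ * (j + 1) + θ := by push_cast; ring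
    have e2 : θ * (j : ℝ) = θ * (j + 1) - θ := by ring
    simp only [korovkinCoeff, g, ← hθ]
    rw [e1, e2, sin_add, sin_sub]
    push_cast
    ring
  rw [Finset.sum_congr rfl this, ← Finset.mul_sum, tele, hg0, hgM]
  simp

/-- The square root `∑ a_j exp(ijt)` of the Fejér–Korovkin kernel. -/
noncomputable def korovkinRoot (M : ℕ) (x : AddCircle (2 * π)) : ℂ :=
  ∑ j : Fin M, (korovkinCoeff M j : ℂ) * fourier (j : ℤ) x

lemma normSq_korovkinRoot (M : ℕ) (x : AddCircle (2 * π)) :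
    (Complex.normSq (korovkinRoot M x) : ℂ) = ∑ p : Fin M × Fin M,
      (korovkinCoeff M p.1 * korovkinCoeff M p.2 : ℂ) * fourier ((p.1 : ℤ) - p.2) x := by
  rw [← Complex.mul_conj, korovkinRoot, map_sum, Finset.sum_mul_sum, ← Finset.univ_product_univ,
    Finset.sum_product]
  refine Finset.sum_congr rfl fun i _ => Finset.sum_congr rfl fun j _ => ?_
  rw [sub_eq_add_neg, fourier_add, fourier_neg, map_mul, Complex.conj_ofReal]
  ring

lemma sum_normSq_korovkinRoot (M : ℕ) (x : AddCircle (2 * π)) :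
    ∑ l : Fin (M + 1), Complex.normSq (korovkinRoot M (x - equiNode (M + 1) l))
      = (M + 1) * ∑ j : Fin M, korovkinCoeff M j ^ 2 := by
  apply Complex.ofReal_injective
  rw [Complex.ofReal_sum]
  simp_rw [normSq_korovkinRoot]
  rw [Finset.sum_comm]
  simp_rw [← Finset.mul_sum]
  have : ∀ p : Fin M × Fin M, ∑ l : Fin (M + 1),
      (fourier ((p.1 : ℤ) - p.2) (x - equiNode (M + 1) l) : ℂ)
      = if p.1 = p.2 then ((M + 1 : ℕ) : ℂ) else 0 := by
    intro p
    rw [sum_fourier_sub_equiNode _ (by rw [abs_lt]; omega)]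
    exact if_congr (by rw [Fin.ext_iff]; omega) rfl rfl
  simp_rw [this]
  rw [← Finset.univ_product_univ, Finset.sum_product]
  simp only [mul_ite, mul_zero, Finset.sum_ite_eq, Finset.mem_univ, if_true]
  push_cast
  rw [Finset.mul_sum]
  exact Finset.sum_congr rfl fun j _ => by ring

lemma sum_normSq_korovkinRoot_mul_re_fourier (M : ℕ) (x : AddCircle (2 * π)) :
    ∑ l : Fin (M + 1), Complex.normSq (korovkinRoot M (x - equiNode (M + 1) l))
        * (fourier 1 (x - equiNode (M + 1) l) : ℂ).re
      = (M + 1) * (cos (π / (M + 1)) * ∑ j : Fin M, korovkinCoeff M j ^ 2) := by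
  rw [← sum_korovkinCoeff_mul_succ]
  have key : ∑ l : Fin (M + 1), (Complex.normSq (korovkinRoot M (x - equiNode (M + 1) l)) : ℂ)
        * (fourier 1 (x - equiNode (M + 1) l) : ℂ)
      = (((M + 1) * ∑ j : Fin M, korovkinCoeff M j * korovkinCoeff M (j + 1) : ℝ) : ℂ) := by
    simp_rw [normSq_korovkinRoot, Finset.sum_mul, mul_assoc, ← fourier_add]
    rw [Finset.sum_comm]
    simp_rw [← Finset.mul_sum]
    have : ∀ p : Fin M × Fin M, ∑ l : Fin (M + 1),
        (fourier ((p.1 : ℤ) - p.2 + 1) (x - equiNode (M + 1) l) : ℂ)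
        = if (p.2 : ℕ) = p.1 + 1 then ((M + 1 : ℕ) : ℂ) else 0 := by
      intro p
      rw [sum_fourier_sub_equiNode _ (by rw [abs_lt]; omega)]
      exact if_congr (by omega) rfl rfl
    simp_rw [this]
    rw [← Finset.univ_product_univ, Finset.sum_product]
    push_cast
    rw [Finset.mul_sum]
    refine Finset.sum_congr rfl fun j _ => ?_
    by_cases hj : (j : ℕ) + 1 < M
    · rw [Finset.sum_eq_single ⟨j + 1, hj⟩]
      · simp; ring
      · intro b _ hb
        rw [if_neg, mul_zero, mul_zero]
        exact fun h => hb (Fin.ext h)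
      · simp
    · have hjM : (j : ℕ) + 1 = M := by omega
      rw [hjM, korovkinCoeff_self, Finset.sum_eq_zero]
      · simp
      · intro b _
        rw [if_neg (by omega), mul_zero, mul_zero]
  have := congrArg Complex.re key
  rw [Complex.ofReal_re, Complex.re_sum] at this
  simpa only [Complex.re_ofReal_mul] using this

/-- A positive partition of unity on the circle by trigonometric polynomials of degree `< M`,
concentrated at scale `1 / M`. -/
lemma exists_trig_partition {M : ℕ} (hM : 1 ≤ M) :
    ∃ (w : Fin (M + 1) → AddCircle (2 * π) → ℝ) (y : Fin (M + 1) → AddCircle (2 * π))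
      (c : Fin (M + 1) → Fin M × Fin M → ℂ),
      (∀ l x, 0 ≤ w l x) ∧ (∀ x, ∑ l, w l x = 1) ∧
      (∀ x, ∑ l, w l x * ‖x - y l‖ ≤ (1 + π ^ 4 / 4) / 2 / M) ∧
      ∀ l x, (w l x : ℂ) = ∑ p, c l p * fourier ((p.1 : ℤ) - p.2) x := by
  set S := ∑ j : Fin M, korovkinCoeff M j ^ 2 with hS
  have hSpos : 0 < S := sum_korovkinCoeff_sq_pos hM
  have hM0 : (0 : ℝ) < M := by exact_mod_cast hM
  let y : Fin (M + 1) → AddCircle (2 * π) := fun l => equiNode (M + 1) l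
  let w : Fin (M + 1) → AddCircle (2 * π) → ℝ :=
    fun l x => Complex.normSq (korovkinRoot M (x - y l)) / ((M + 1) * S)
  have w_nonneg : ∀ l x, 0 ≤ w l x := fun l x => div_nonneg (Complex.normSq_nonneg _) (by positivity)
  have w_sum : ∀ x, ∑ l, w l x = 1 := by
    intro x
    rw [← Finset.sum_div, sum_normSq_korovkinRoot]
    exact div_self (by positivity)
  have w_cos : ∀ x, ∑ l, w l x * (fourier 1 (x - y l) : ℂ).re = cos (π / (M + 1)) := by
    intro x
    simp only [w, div_mul_eq_mul_div]
    rw [← Finset.sum_div, sum_normSq_korovkinRoot_mul_re_fourier, ← hS]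
    field_simp
  refine ⟨w, y, fun l p => (korovkinCoeff M p.1 * korovkinCoeff M p.2 : ℂ)
    * fourier ((p.1 : ℤ) - p.2) (-y l) / ((M + 1) * S : ℝ), w_nonneg, w_sum, ?_, ?_⟩
  · intro x
    have hcos : 1 - cos (π / (M + 1)) ≤ π ^ 2 / 2 / M ^ 2 := by
      have h1 := one_sub_sq_div_two_le_cos (x := π / (M + 1))
      have h2 : (π / (M + 1)) ^ 2 ≤ (π / M) ^ 2 := by gcongr; linarith
      rw [div_pow π (M : ℝ)] at h2
      calc 1 - cos (π / (M + 1)) ≤ (π / (M + 1)) ^ 2 / 2 := by linarith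
        _ ≤ (π ^ 2 / M ^ 2) / 2 := by gcongr
        _ = _ := by ring
    calc ∑ l, w l x * ‖x - y l‖
        ≤ ∑ l, w l x * (1 / 2 * (1 / M + M * (π ^ 2 / 2 * (1 - (fourier 1 (x - y l) : ℂ).re)))) := by
          refine Finset.sum_le_sum fun l _ => mul_le_mul_of_nonneg_left ?_ (w_nonneg l x)
          have h1 := norm_sq_le_one_sub_re_fourier (x - y l)
          have h2 : 2 * ‖x - y l‖ ≤ 1 / M + M * ‖x - y l‖ ^ 2 := by
            have : 0 ≤ (1 - M * ‖x - y l‖) ^ 2 / M := by positivity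
            have e : (1 - M * ‖x - y l‖) ^ 2 / M
              = 1 / M + M * ‖x - y l‖ ^ 2 - 2 * ‖x - y l‖ := by field_simp; ring
            linarith
          have h3 := mul_le_mul_of_nonneg_left h1 hM0.le
          linarith
      _ = 1 / 2 * (1 / M + M * (π ^ 2 / 2)) * ∑ l, w l x
          - 1 / 2 * (M * (π ^ 2 / 2)) * ∑ l, w l x * (fourier 1 (x - y l) : ℂ).re := by
          rw [Finset.mul_sum, Finset.mul_sum, ← Finset.sum_sub_distrib]
          exact Finset.sum_congr rfl fun l _ => by ring
      _ = 1 / 2 * (1 / M + M * (π ^ 2 / 2) * (1 - cos (π / (M + 1)))) := by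
          rw [w_sum, w_cos]; ring
      _ ≤ 1 / 2 * (1 / M + M * (π ^ 2 / 2) * (π ^ 2 / 2 / M ^ 2)) := by gcongr
      _ = _ := by field_simp; ring
  · intro l x
    simp only [w]
    rw [Complex.ofReal_div, normSq_korovkinRoot, Finset.sum_div]
    refine Finset.sum_congr rfl fun p _ => ?_
    have : (fourier ((p.1 : ℤ) - p.2) (x - y l) : ℂ)
        = fourier ((p.1 : ℤ) - p.2) x * fourier ((p.1 : ℤ) - p.2) (-y l) := by
      simp only [sub_eq_add_neg x, fourier_apply, smul_add, AddCircle.toCircle_add, Circle.coe_mul]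
    rw [this]
    ring

/-! ### Lipschitz estimate on the torus -/

lemma bddAbove_norm_fderiv_liftT {q : ℕ} {f : C(Torus q, ℂ)} (hf : MemW f) (v : Fin q → ℝ) :
    BddAbove (Set.range fun x => ‖fderiv ℝ (liftT f) x v‖) := by
  have hcont : Continuous fun x => ‖fderiv ℝ (liftT f) x v‖ :=
    ((hf.continuous_fderiv one_ne_zero).clm_apply continuous_const).norm
  have hper : ∀ x : Fin q → ℝ, ∃ z ∈ Set.pi Set.univ fun _ : Fin q => Set.Icc (0 : ℝ) (2 * π),
      fderiv ℝ (liftT f) z = fderiv ℝ (liftT f) x := by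
    intro x
    let z : Fin q → ℝ := fun j => toIcoMod two_pi_pos 0 (x j)
    refine ⟨z, fun j _ => ?_, ?_⟩
    · have := toIcoMod_mem_Ico two_pi_pos 0 (x j)
      rw [zero_add] at this
      exact Set.Ico_subset_Icc_self this
    · have hT : (fun u => liftT f (u + (x - z))) = liftT f := by
        funext u
        simp only [liftT]
        congr 1
        funext j
        have : x j - z j = toIcoDiv two_pi_pos 0 (x j) • (2 * π) := self_sub_toIcoMod _ _ _
        simp only [projT, Pi.add_apply, Pi.sub_apply, this, AddCircle.coe_add, AddCircle.coe_zsmul,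
          AddCircle.coe_period, smul_zero, add_zero]
      have := fderiv_comp_add_right (𝕜 := ℝ) (f := liftT f) (x := z) (x - z)
      rw [hT, add_sub_cancel] at this
      exact this
  obtain ⟨C, hC⟩ := ((isCompact_univ_pi fun _ : Fin q => isCompact_Icc
    (a := (0 : ℝ)) (b := 2 * π)).image hcont).bddAbove
  refine ⟨C, ?_⟩
  rintro _ ⟨x, rfl⟩
  obtain ⟨z, hz, hzx⟩ := hper x
  exact hC ⟨z, hz, by simp only [hzx]⟩

lemma norm_sub_le_sum_iSup_norm_fderiv {q : ℕ} {f : C(Torus q, ℂ)} (hf : MemW f) (x y : Torus q) :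
    ‖f x - f y‖
      ≤ ∑ j, (⨆ z : Fin q → ℝ, ‖fderiv ℝ (liftT f) z (Pi.single j 1)‖) * ‖x j - y j‖ := by
  choose d hd hdn using fun j => exists_coe_eq_abs_eq_norm (x j - y j)
  obtain ⟨Y, hY⟩ : ∃ Y : Fin q → ℝ, projT Y = y := by
    choose Y hY using fun j => QuotientAddGroup.mk_surjective (y j)
    exact ⟨Y, funext hY⟩
  have hX : projT (Y + d) = x := by
    funext j
    have := congrFun hY j
    simp only [projT] at this
    simp only [projT, Pi.add_apply, AddCircle.coe_add, this, hd, add_sub_cancel]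
  have hdiff : Differentiable ℝ (liftT f) := ContDiff.differentiable hf one_ne_zero
  have hbound : ∀ z, ‖fderiv ℝ (liftT f) z d‖
      ≤ ∑ j, (⨆ z : Fin q → ℝ, ‖fderiv ℝ (liftT f) z (Pi.single j 1)‖) * ‖x j - y j‖ := by
    intro z
    have hsum : d = ∑ j, d j • (Pi.single j (1 : ℝ) : Fin q → ℝ) := by
      simp [← Pi.single_smul, Finset.univ_sum_single]
    conv_lhs => rw [hsum, map_sum]
    refine (norm_sum_le _ _).trans (Finset.sum_le_sum fun j _ => ?_)
    rw [map_smul, norm_smul, Real.norm_eq_abs, hdn, mul_comm]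
    exact mul_le_mul_of_nonneg_right (le_ciSup (bddAbove_norm_fderiv_liftT hf _) z) (norm_nonneg _)
  have hderiv : ∀ t : ℝ, HasDerivAt (fun t : ℝ => liftT f (Y + t • d))
      (fderiv ℝ (liftT f) (Y + t • d) d) t := by
    intro t
    have h1 : HasDerivAt (fun t : ℝ => Y + t • d) d t := by
      simpa using ((hasDerivAt_id t).smul_const d).const_add Y
    exact (hdiff _).hasFDerivAt.comp_hasDerivAt t h1
  have := norm_image_sub_le_of_norm_deriv_le_segment_01'
    (fun t _ => (hderiv t).hasDerivWithinAt) (fun t _ => hbound (Y + t • d))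
  simpa [liftT, hX, hY] using this

/-! ### The approximating polynomial -/

lemma l2_le_of_abs_le {q : ℕ} {k : Fin q → ℤ} {m : ℝ} (hm : 0 ≤ m)
    (hk : ∀ j, |(k j : ℝ)| ≤ m) : l2 k ≤ q * m := by
  refine sqrt_le_iff.2 ⟨by positivity, ?_⟩
  calc ∑ j, (k j : ℝ) ^ 2 ≤ ∑ _j : Fin q, m ^ 2 :=
        Finset.sum_le_sum fun j _ => sq_le_sq' (abs_le.1 (hk j)).1 (abs_le.1 (hk j)).2
    _ = q * m ^ 2 := by simp
    _ ≤ (q : ℝ) ^ 2 * m ^ 2 := by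
        gcongr
        exact_mod_cast Nat.le_self_pow two_ne_zero q
    _ = _ := by ring

lemma degApprox_le_of_mem {q : ℕ} {N : ℝ} {f T : C(Torus q, ℂ)} (hT : T ∈ trigSpan q N) :
    degApprox q N f ≤ ‖f - T‖ :=
  ciInf_le (f := fun T : ↥(trigSpan q N) => ‖f - (T : C(Torus q, ℂ))‖)
    ⟨0, by rintro _ ⟨T, rfl⟩; exact norm_nonneg _⟩ ⟨T, hT⟩

lemma sum_prod_mul_apply {ι κ : Type*} [Fintype ι] [DecidableEq ι] [Fintype κ]
    (w : ι → κ → ℝ) (hw : ∀ i, ∑ l, w i l = 1) (j : ι) (g : κ → ℝ) :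
    ∑ l : ι → κ, (∏ i, w i (l i)) * g (l j) = ∑ a, w j a * g a := by
  have h1 : ∀ l : ι → κ, (∏ i, w i (l i)) * g (l j)
      = ∏ i, (w i (l i) * if i = j then g (l i) else 1) := by
    intro l
    rw [Finset.prod_mul_distrib, Finset.prod_ite_eq' Finset.univ j]
    simp
  simp_rw [h1]
  rw [← Fintype.prod_sum (fun i a => w i a * if i = j then g a else 1),
    Finset.prod_eq_single j]
  · simp
  · intro i _ hij
    simp [hij, hw]
  · simp

lemma exists_trigSpan_norm_sub_le {q M : ℕ} (hM : 1 ≤ M) {N : ℝ} (hN : q * ((M : ℝ) - 1) < N)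
    {f : C(Torus q, ℂ)} (hf : MemW f) :
    ∃ T ∈ trigSpan q N, ‖f - T‖ ≤ (1 + π ^ 4 / 4) / 2 / M * Wnorm f := by
  obtain ⟨w, y, c, w_nonneg, w_sum, w_moment, w_eq⟩ := exists_trig_partition hM
  let T : C(Torus q, ℂ) := ∑ l : Fin q → Fin (M + 1), f (fun j => y (l j)) •
    ∑ p : Fin q → Fin M × Fin M, (∏ j, c (l j) (p j)) • eK fun j => ((p j).1 : ℤ) - (p j).2
  have hTapply : ∀ x, T x = ∑ l : Fin q → Fin (M + 1),
      ((∏ j, w (l j) (x j) : ℝ) : ℂ) * f (fun j => y (l j)) := by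
    intro x
    simp only [T, ContinuousMap.coe_sum, ContinuousMap.coe_smul, Finset.sum_apply, Pi.smul_apply,
      smul_eq_mul]
    refine Finset.sum_congr rfl fun l _ => ?_
    rw [mul_comm, Complex.ofReal_prod]
    simp_rw [w_eq]
    rw [Fintype.prod_sum]
    simp only [Finset.prod_mul_distrib, eK, ContinuousMap.coe_mk]
  have hW0 : 0 ≤ Wnorm f :=
    Finset.sum_nonneg fun j _ => Real.iSup_nonneg fun _ => norm_nonneg _
  refine ⟨T, ?_, ?_⟩
  · refine Submodule.sum_mem _ fun l _ => Submodule.smul_mem _ _ <|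
      Submodule.sum_mem _ fun p _ => Submodule.smul_mem _ _ <| Submodule.subset_span
        ⟨_, lt_of_le_of_lt (l2_le_of_abs_le (sub_nonneg.2 (by exact_mod_cast hM)) fun j => ?_) hN,
          rfl⟩
    have : |((p j).1 : ℤ) - (p j).2| ≤ (M : ℤ) - 1 := by rw [abs_le]; omega
    exact_mod_cast this
  · refine (ContinuousMap.norm_le _ (by positivity)).2 fun x => ?_
    have hone : ∑ l : Fin q → Fin (M + 1), ∏ j, w (l j) (x j) = 1 := by
      rw [← Fintype.prod_sum (fun j a => w a (x j))]
      simp [w_sum]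
    have hdiff : (f - T) x = ∑ l : Fin q → Fin (M + 1),
        ((∏ j, w (l j) (x j) : ℝ) : ℂ) * (f x - f fun j => y (l j)) := by
      simp_rw [mul_sub]
      rw [Finset.sum_sub_distrib, ← Finset.sum_mul, ← Complex.ofReal_sum, hone, ContinuousMap.sub_apply,
        hTapply]
      simp
    let A : Fin q → ℝ := fun j => ⨆ z : Fin q → ℝ, ‖fderiv ℝ (liftT f) z (Pi.single j 1)‖
    have hA : ∀ j, 0 ≤ A j := fun j => Real.iSup_nonneg fun _ => norm_nonneg _
    calc ‖(f - T) x‖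
        ≤ ∑ l : Fin q → Fin (M + 1), (∏ j, w (l j) (x j)) * ∑ j, A j * ‖x j - y (l j)‖ := by
          rw [hdiff]
          refine (norm_sum_le _ _).trans (Finset.sum_le_sum fun l _ => ?_)
          have h0 : 0 ≤ ∏ j, w (l j) (x j) := Finset.prod_nonneg fun j _ => w_nonneg _ _
          rw [norm_mul, Complex.norm_real, Real.norm_of_nonneg h0]
          exact mul_le_mul_of_nonneg_left (norm_sub_le_sum_iSup_norm_fderiv hf _ _) h0
      _ = ∑ j, A j * ∑ a, w a (x j) * ‖x j - y a‖ := by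
          simp_rw [Finset.mul_sum (Finset.univ : Finset (Fin q))]
          rw [Finset.sum_comm]
          refine Finset.sum_congr rfl fun j _ => ?_
          rw [← sum_prod_mul_apply (fun i a => w a (x i)) (fun i => w_sum (x i)) j
            (fun a => ‖x j - y a‖), Finset.mul_sum]
          exact Finset.sum_congr rfl fun l _ => by ring
      _ ≤ ∑ j, A j * ((1 + π ^ 4 / 4) / 2 / M) :=
          Finset.sum_le_sum fun j _ => mul_le_mul_of_nonneg_left (w_moment (x j)) (hA j)
      _ = _ := by rw [← Finset.sum_mul, mul_comm, Wnorm]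

/-- direct theorem of trigonometric approximation: if `f ∈ W*(𝕋^q)` then
`E_N(q; f) ≤ (c/N) ‖f‖_{W*}` for every `N ≥ 1`. -/
theorem direct_theorem (q : ℕ) :
    ∃ c > 0, ∀ f : C(Torus q, ℂ), MemW f → ∀ N : ℝ, 1 ≤ N →
      degApprox q N f ≤ c / N * Wnorm f := by
  refine ⟨(1 + π ^ 4 / 4) / 2 * (q + 1), by positivity, fun f hf N hN => ?_⟩
  have hN0 : 0 < N := by linarith
  set m := ⌊N / (q + 1)⌋₊ with hm
  have hle : (m : ℝ) ≤ N / (q + 1) := Nat.floor_le (by positivity)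
  have hlt : N / (q + 1) < m + 1 := Nat.lt_floor_add_one _
  rw [le_div_iff₀ (by positivity)] at hle
  obtain ⟨T, hT, hTf⟩ := exists_trigSpan_norm_sub_le (q := q) (M := m + 1) (N := N) (by omega)
    (by
      push_cast
      rcases Nat.eq_zero_or_pos m with h0 | h0
      · simpa [h0] using hN0
      · have : (0 : ℝ) < m := by exact_mod_cast h0
        linarith) hf
  refine (degApprox_le_of_mem hT).trans (hTf.trans ?_)
  have hW0 : 0 ≤ Wnorm f :=
    Finset.sum_nonneg fun j _ => Real.iSup_nonneg fun _ => norm_nonneg _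
  refine mul_le_mul_of_nonneg_right ?_ hW0
  rw [div_le_div_iff₀ (by positivity) hN0, mul_assoc]
  refine mul_le_mul_of_nonneg_left ?_ (by positivity)
  rw [div_lt_iff₀ (by positivity)] at hlt
  push_cast
  linarith
end
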